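/- arXiv:0908.0475 — 8 statements merged into one kernel-verified Lean document; each statement's English description precedes it below -/
import Mathlib

section
/- Fix an integer n ≥ 1. Every element X of the class χ^<_n of all finite ordered n-chromatic graphs has a finite Ramsey degree in χ^<_n equal to σ(X), the number of non-isomorphic extensions of X in K^<_n. That is: σ(X) is the least natural number t such that for every Y ∈ χ^<_n and every k ∈ ℕ there exists Z ∈ χ^<_n such that for every map α from the copies of X in Z to {1,…,k} there is a copy Ỹ of Y in Z such that α takes at most t values on the copies of X in Ỹ. -/
/-- `f` is an embedding of ordered graphs (vertex sets `Fin a`, `Fin c` with their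
natural linear orders): strictly increasing, preserving and reflecting adjacency. -/
def OrdEmb {a c : ℕ} (X : SimpleGraph (Fin a)) (Z : SimpleGraph (Fin c))
    (f : Fin a → Fin c) : Prop :=
  StrictMono f ∧ ∀ i j, Z.Adj (f i) (f j) ↔ X.Adj i j

/-- `lam` is a proper coloring of `X` with colors in `Fin n`. -/
def ProperCol {a n : ℕ} (X : SimpleGraph (Fin a)) (lam : Fin a → Fin n) : Prop :=
  ∀ i j, X.Adj i j → lam i ≠ lam j

/-- `f` is an embedding of ordered `[n]`-colored graphs: an ordered-graph embedding
that also preserves the vertex colorings. -/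
def ColOrdEmb {n a c : ℕ} (X : SimpleGraph (Fin a)) (lamX : Fin a → Fin n)
    (Z : SimpleGraph (Fin c)) (lamZ : Fin c → Fin n) (f : Fin a → Fin c) : Prop :=
  OrdEmb X Z f ∧ ∀ i, lamZ (f i) = lamX i

/-- `S` is the vertex set of an induced copy of the (unordered) graph `X` in `Z`. -/
def IsCopy {a c : ℕ} (X : SimpleGraph (Fin a)) (Z : SimpleGraph (Fin c))
    (S : Finset (Fin c)) : Prop :=
  ∃ f : Fin a → Fin c, Function.Injective f ∧
    (∀ i j, Z.Adj (f i) (f j) ↔ X.Adj i j) ∧ Finset.image f Finset.univ = S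

/-- If Ramsey's theorem holds for `a`-element subsets, then large sets have large subsets on
which the color of an `(a + 1)`-element subset depends only on its minimum. -/
theorem exists_endHomogeneous {κ : Type*} {a : ℕ}
    (H : ∀ b : ℕ, ∃ p : ℕ, ∀ (c : Finset ℕ → κ) (S : Finset ℕ), p ≤ S.card →
      ∃ T ⊆ S, T.card = b ∧
        ∀ A ⊆ T, ∀ A' ⊆ T, A.card = a → A'.card = a → c A = c A') (m : ℕ) :
    ∃ p : ℕ, ∀ (c : Finset ℕ → κ) (S : Finset ℕ), p ≤ S.card →
      ∃ T ⊆ S, T.card = m ∧ ∃ d : ℕ → κ,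
        ∀ x ∈ T, ∀ A ⊆ T, A.card = a → (∀ y ∈ A, x < y) → c (insert x A) = d x := by
  classical
  induction m with
  | zero =>
    exact ⟨0, fun c S _ => ⟨∅, by simp, rfl, fun _ => c ∅, by simp⟩⟩
  | succ m ih =>
    obtain ⟨q, hq⟩ := ih
    obtain ⟨p, hp⟩ := H q
    refine ⟨p + 1, fun c S hS => ?_⟩
    have hne : S.Nonempty := Finset.card_pos.mp (by omega)
    set x := S.min' hne with hx
    have hxS : x ∈ S := S.min'_mem hne
    obtain ⟨T₁, hT₁, hT₁c, hT₁h⟩ := hp (fun A => c (insert x A)) (S.erase x)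
      (by rw [Finset.card_erase_of_mem hxS]; omega)
    obtain ⟨T, hT, hTc, d, hd⟩ := hq c T₁ hT₁c.ge
    have hlt : ∀ y ∈ T, x < y := fun y hy =>
      Finset.min'_lt_of_mem_erase_min' _ hne (hT₁ (hT hy))
    have hxT : x ∉ T := fun h => lt_irrefl _ (hlt x h)
    obtain ⟨e, he⟩ : ∃ e : κ, ∀ A ⊆ T, A.card = a → c (insert x A) = e := by
      by_cases h : ∃ A ⊆ T, A.card = a
      · obtain ⟨A, hA, hAc⟩ := h
        exact ⟨c (insert x A), fun A' hA' hc' =>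
          hT₁h A' (hA'.trans hT) A (hA.trans hT) hc' hAc⟩
      · exact ⟨c ∅, fun A hA hAc => (h ⟨A, hA, hAc⟩).elim⟩
    refine ⟨insert x T, ?_, by rw [Finset.card_insert_of_notMem hxT, hTc],
      Function.update d x e, fun y hy A hA hAc hAy => ?_⟩
    · exact Finset.insert_subset hxS
        (hT.trans (hT₁.trans (Finset.erase_subset _ _)))
    · have hxA : x ∉ A := by
        intro h
        rcases Finset.mem_insert.mp hy with rfl | hyT
        · exact lt_irrefl _ (hAy _ h)
        · exact lt_asymm (hAy _ h) (hlt y hyT)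
      have hAT : A ⊆ T := fun z hz =>
        (Finset.mem_insert.mp (hA hz)).resolve_left fun h => hxA (h ▸ hz)
      rcases Finset.mem_insert.mp hy with rfl | hyT
      · rw [Function.update_self]
        exact he A hAT hAc
      · rw [Function.update_of_ne (hlt y hyT).ne']
        exact hd y hyT A hAT hAc hAy

/-- The finite Ramsey theorem for colorings of the `a`-element subsets. -/
theorem exists_homogeneous_finset (κ : Type*) [Finite κ] (a b : ℕ) :
    ∃ p : ℕ, ∀ (c : Finset ℕ → κ) (S : Finset ℕ), p ≤ S.card →
      ∃ T ⊆ S, T.card = b ∧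
        ∀ A ⊆ T, ∀ A' ⊆ T, A.card = a → A'.card = a → c A = c A' := by
  classical
  have := Fintype.ofFinite κ
  induction a generalizing b with
  | zero =>
    refine ⟨b, fun c S hS => ?_⟩
    obtain ⟨T, hT, hTc⟩ := Finset.exists_subset_card_eq hS
    refine ⟨T, hT, hTc, fun A _ A' _ hA hA' => ?_⟩
    rw [Finset.card_eq_zero.mp hA, Finset.card_eq_zero.mp hA']
  | succ a ih =>
    obtain ⟨p, hp⟩ := exists_endHomogeneous ih (Fintype.card κ * b + 1)
    refine ⟨p, fun c S hS => ?_⟩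
    obtain ⟨T, hT, hTc, d, hd⟩ := hp c S hS
    obtain ⟨y, -, hy⟩ := Finset.exists_lt_card_fiber_of_mul_lt_card_of_maps_to
      (s := T) (t := Finset.univ) (f := d) (n := b) (fun _ _ => Finset.mem_univ _)
      (by rw [hTc, Finset.card_univ]; omega)
    obtain ⟨T', hT', hT'c⟩ := Finset.exists_subset_card_eq hy.le
    have key : ∀ A ⊆ T', A.card = a + 1 → c A = y := by
      intro A hA hAc
      have hne : A.Nonempty := Finset.card_pos.mp (by omega)
      have hm := A.min'_mem hne
      have hmT := Finset.mem_filter.mp (hT' (hA hm))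
      rw [← Finset.insert_erase hm, hd _ hmT.1 (A.erase _) ?_ ?_ ?_, hmT.2]
      · exact fun z hz =>
          (Finset.mem_filter.mp (hT' (hA (Finset.mem_of_mem_erase hz)))).1
      · rw [Finset.card_erase_of_mem hm, hAc]; rfl
      · exact fun z hz => Finset.min'_lt_of_mem_erase_min' _ hne hz
    exact ⟨T', hT'.trans ((Finset.filter_subset _ _).trans hT), hT'c,
      fun A hA A' hA' hc hc' => (key A hA hc).trans (key A' hA' hc').symm⟩

/-- The finite Ramsey theorem for colorings of increasing `a`-tuples. -/
theorem exists_homogeneous_strictMono (κ : Type*) [Finite κ] (a b : ℕ) :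
    ∃ p : ℕ, ∀ c : (Fin a → Fin p) → κ, ∃ g : Fin b → Fin p, StrictMono g ∧
      ∀ h h' : Fin a → Fin b, StrictMono h → StrictMono h' → c (g ∘ h) = c (g ∘ h') := by
  classical
  obtain ⟨p, hp⟩ := exists_homogeneous_finset (Option κ) a b
  refine ⟨p, fun c => ?_⟩
  obtain ⟨T, hT, hTc, hTh⟩ := hp
    (fun A => if h : ∃ s : Fin a → Fin p, StrictMono s ∧
      A = Finset.univ.image (fun i => (s i : ℕ)) then some (c h.choose) else none)
    (Finset.range p) (by simp)
  have hg : ∀ i, T.orderEmbOfFin hTc i < p := fun i =>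
    Finset.mem_range.mp (hT (T.orderEmbOfFin_mem hTc i))
  have hmono : StrictMono (fun i => (⟨T.orderEmbOfFin hTc i, hg i⟩ : Fin p)) :=
    fun i j hij => (T.orderEmbOfFin hTc).strictMono hij
  refine ⟨_, hmono, fun h h' hh hh' => ?_⟩
  set g : Fin b → Fin p := fun i => ⟨T.orderEmbOfFin hTc i, hg i⟩ with hgdef
  have inj : ∀ s t : Fin a → Fin p, StrictMono s → StrictMono t →
      Finset.univ.image (fun i => (s i : ℕ)) = Finset.univ.image (fun i => (t i : ℕ)) →
      s = t := by
    intro s t hs ht hst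
    refine StrictMono.range_inj hs ht |>.mp ?_
    have := congrArg (fun A : Finset ℕ => (A : Set ℕ)) hst
    simp only [Finset.coe_image, Finset.coe_univ, Set.image_univ] at this
    ext x
    have := Set.ext_iff.mp this x
    simpa [Fin.val_inj] using this
  have sub : ∀ h : Fin a → Fin b, Finset.univ.image (fun i => (g (h i) : ℕ)) ⊆ T := by
    intro h x hx
    obtain ⟨i, -, rfl⟩ := Finset.mem_image.mp hx
    exact T.orderEmbOfFin_mem hTc _
  have crd : ∀ h : Fin a → Fin b, StrictMono h →
      (Finset.univ.image (fun i => (g (h i) : ℕ))).card = a := by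
    intro h hh
    have hinj : Function.Injective fun i => (g (h i) : ℕ) :=
      Fin.val_injective.comp (hmono.comp hh).injective
    rw [Finset.card_image_of_injective _ hinj, Finset.card_univ, Fintype.card_fin]
  have col : ∀ h : Fin a → Fin b, StrictMono h →
      (if h' : ∃ s : Fin a → Fin p, StrictMono s ∧
        Finset.univ.image (fun i => (g (h i) : ℕ)) = Finset.univ.image (fun i => (s i : ℕ))
        then some (c h'.choose) else none) = some (c (g ∘ h)) := by
    intro h hh
    have hex : ∃ s : Fin a → Fin p, StrictMono s ∧
        Finset.univ.image (fun i => (g (h i) : ℕ)) =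
          Finset.univ.image (fun i => (s i : ℕ)) := ⟨g ∘ h, hmono.comp hh, rfl⟩
    rw [dif_pos hex]
    rw [inj (g ∘ h) hex.choose (hmono.comp hh) hex.choose_spec.1 hex.choose_spec.2]
  have := hTh _ (sub h) _ (sub h') (crd h hh) (crd h' hh')
  rw [col h hh, col h' hh'] at this
  exact Option.some_injective _ this

/-- A finite structure with an `L`-valued binary relation and a partition into parts
indexed by `P`. -/
structure PartiteSystem (L P : Type) where
  carrier : Type
  finite : Finite carrier
  proj : carrier → P
  rel : carrier → carrier → L

namespace PartiteSystem

variable {L P : Type}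

/-- Part-preserving and relation-preserving maps of partite systems. -/
def IsHom (V W : PartiteSystem L P) (φ : V.carrier → W.carrier) : Prop :=
  (∀ v, W.proj (φ v) = V.proj v) ∧ ∀ u v, W.rel (φ u) (φ v) = V.rel u v

/-- `f` is a copy in `V` of the structure `A`, with vertices in the parts given by `s`. -/
def IsCopyOver {I : Type} (A : I → I → L) (s : I → P) (V : PartiteSystem L P)
    (f : I → V.carrier) : Prop :=
  (∀ i, V.proj (f i) = s i) ∧ ∀ i j, V.rel (f i) (f j) = A i j

theorem IsCopyOver.comp {I : Type} {A : I → I → L} {s : I → P} {V W : PartiteSystem L P}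
    {f : I → V.carrier} {φ : V.carrier → W.carrier} (hφ : IsHom V W φ)
    (hf : IsCopyOver A s V f) : IsCopyOver A s W (φ ∘ f) :=
  ⟨fun i => (hφ.1 _).trans (hf.1 i), fun i j => (hφ.2 _ _).trans (hf.2 i j)⟩

theorem IsHom.comp {U V W : PartiteSystem L P} {φ : U.carrier → V.carrier}
    {ψ : V.carrier → W.carrier} (hψ : IsHom V W ψ) (hφ : IsHom U V φ) :
    IsHom U W (ψ ∘ φ) :=
  ⟨fun v => (hψ.1 _).trans (hφ.1 v), fun u v => (hψ.2 _ _).trans (hφ.2 u v)⟩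

open Classical in
/-- Some value of `g` different from `x` if there is one, and `x` otherwise. -/
noncomputable def exceptional {ι : Type} (x : L) (g : ι → L) : L :=
  if h : ∃ n, g n ≠ x then g h.choose else x

theorem exceptional_eq {ι : Type} {x y : L} {g : ι → L} (hg : ∀ n, g n = x ∨ g n = y)
    (hy : ∃ n, g n = y) : exceptional x g = y := by
  unfold exceptional
  split_ifs with h
  · exact (hg _).resolve_left h.choose_spec
  · push Not at h
    obtain ⟨n, hn⟩ := hy
    rw [← hn, h n]

/-- The amalgam of copies of `V` along a Hales–Jewett power of its parts in the range of `s`. -/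
noncomputable def amalgam {I : Type} [Finite I] (A : I → I → L) (s : I → P)
    (V : PartiteSystem L P) (ι : Type) [Finite ι] : PartiteSystem L P where
  carrier := (I × (ι → V.carrier)) ⊕ (ι × V.carrier)
  finite := by
    have := V.finite
    infer_instance
  proj := Sum.elim (fun x => s x.1) (fun x => V.proj x.2)
  rel
    | .inl x, .inl y => exceptional (A x.1 y.1) fun n => V.rel (x.2 n) (y.2 n)
    | .inl x, .inr y => V.rel (x.2 y.1) y.2
    | .inr x, .inl y => V.rel x.2 (y.2 x.1)
    | .inr x, .inr y => V.rel x.2 y.2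

/-- The partite lemma together with one amalgamation step. -/
theorem exists_mono_over {I : Type} [Finite I] (A : I → I → L) (s : I → P)
    (hs : Function.Injective s) (V : PartiteSystem L P) (κ : Type) [Finite κ] :
    ∃ W : PartiteSystem L P, ∀ α : (I → W.carrier) → κ,
      ∃ φ, IsHom V W φ ∧ ∃ d, ∀ f, IsCopyOver A s V f → α (φ ∘ f) = d := by
  classical
  have := V.finite
  obtain ⟨ι, _, hι⟩ := Combinatorics.Line.exists_mono_in_high_dimension
    {f : I → V.carrier // IsCopyOver A s V f} κ
  refine ⟨amalgam A s V ι, fun α => ?_⟩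
  obtain ⟨l, d, hl⟩ := hι fun F => α fun i => Sum.inl (i, fun n => (F n).1 i)
  obtain ⟨n₀, hn₀⟩ := l.proper
  let w (v : V.carrier) (i : I) (n : ι) : V.carrier := (l.idxFun n).elim v fun F => F.1 i
  have hw₀ : ∀ v i, w v i n₀ = v := fun v i => by simp [w, hn₀]
  let φ : V.carrier → (amalgam A s V ι).carrier := fun v =>
    if h : ∃ i, s i = V.proj v then Sum.inl (h.choose, w v h.choose) else Sum.inr (n₀, v)
  have hφs : ∀ v i, s i = V.proj v → φ v = Sum.inl (i, w v i) := by
    intro v i hi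
    have h : ∃ i, s i = V.proj v := ⟨i, hi⟩
    have : h.choose = i := hs (h.choose_spec.trans hi.symm)
    rw [← this]
    exact dif_pos h
  have hφn : ∀ v, (¬ ∃ i, s i = V.proj v) → φ v = Sum.inr (n₀, v) := by
    intro v h
    exact dif_neg h
  refine ⟨φ, ⟨fun v => ?_, fun u v => ?_⟩, d, fun f hf => ?_⟩
  · by_cases h : ∃ i, s i = V.proj v
    · obtain ⟨i, hi⟩ := h
      rw [hφs v i hi]
      exact hi
    · rw [hφn v h]
      rfl
  · by_cases hu : ∃ i, s i = V.proj u
    · obtain ⟨i, hi⟩ := hu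
      rw [hφs u i hi]
      by_cases hv : ∃ i, s i = V.proj v
      · obtain ⟨j, hj⟩ := hv
        rw [hφs v j hj]
        refine exceptional_eq (fun n => ?_) ⟨n₀, ?_⟩
        · rcases h : l.idxFun n with _ | F
          · right; simp [w, h]
          · left; simpa [w, h] using F.2.2 i j
        · simp only [hw₀]
      · rw [hφn v hv]
        change V.rel (w u i n₀) v = _
        rw [hw₀]
    · rw [hφn u hu]
      by_cases hv : ∃ i, s i = V.proj v
      · obtain ⟨j, hj⟩ := hv
        rw [hφs v j hj]
        change V.rel u (w v j n₀) = _
        rw [hw₀]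
      · rw [hφn v hv]
        rfl
  · rw [← hl ⟨f, hf⟩]
    congr 1
    funext i
    rw [Function.comp_apply, hφs (f i) i (hf.1 i).symm]
    congr 2
    funext n
    rcases h : l.idxFun n with _ | F <;> simp [w, h]

/-- The partite construction, over finitely many structures and projections. -/
theorem exists_mono_over_finset {I Λ : Type} [Finite I] (A : Λ → I → I → L)
    (κ : Type) [Finite κ] (S : Finset (Λ × (I → P))) (hS : ∀ q ∈ S, Function.Injective q.2)
    (V : PartiteSystem L P) :
    ∃ W : PartiteSystem L P, ∀ α : (I → W.carrier) → κ,
      ∃ φ, IsHom V W φ ∧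
        ∀ q ∈ S, ∃ d, ∀ f, IsCopyOver (A q.1) q.2 V f → α (φ ∘ f) = d := by
  classical
  induction S using Finset.induction_on generalizing V with
  | empty => exact ⟨V, fun α => ⟨id, ⟨fun _ => rfl, fun _ _ => rfl⟩, by simp⟩⟩
  | insert q S _ ih =>
    obtain ⟨V₁, h₁⟩ := exists_mono_over (A q.1) q.2 (hS q (Finset.mem_insert_self _ _)) V κ
    obtain ⟨W, hW⟩ := ih (fun r hr => hS r (Finset.mem_insert_of_mem hr)) V₁
    refine ⟨W, fun α => ?_⟩
    obtain ⟨ψ, hψ, hψS⟩ := hW α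
    obtain ⟨φ, hφ, d, hd⟩ := h₁ fun f => α (ψ ∘ f)
    refine ⟨ψ ∘ φ, hψ.comp hφ, fun r hr => ?_⟩
    rcases Finset.mem_insert.mp hr with rfl | hr
    · exact ⟨d, hd⟩
    · obtain ⟨e, he⟩ := hψS r hr
      exact ⟨e, fun f hf => he _ (hf.comp hφ)⟩

/-- The parts of a finite partite system over a linear order can be made consecutive
intervals of a linear order on the vertices. -/
theorem exists_enumeration [LinearOrder P] (V : PartiteSystem L P) :
    ∃ (c : ℕ) (ε : V.carrier ≃ Fin c), ∀ u v, V.proj u < V.proj v → ε u < ε v := by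
  classical
  have := V.finite
  have := Fintype.ofFinite V.carrier
  let enc : V.carrier → P ×ₗ Fin (Fintype.card V.carrier) := fun v =>
    toLex (V.proj v, Fintype.equivFin V.carrier v)
  have henc : Function.Injective enc := fun u v h =>
    (Fintype.equivFin V.carrier).injective (congrArg (fun x => (ofLex x).2) h)
  let : LinearOrder V.carrier := LinearOrder.lift' enc henc
  let o := Fintype.orderIsoFinOfCardEq V.carrier rfl
  refine ⟨_, o.symm.toEquiv, fun u v h => ?_⟩
  have : u < v := show enc u < enc v from Prod.Lex.toLex_lt_toLex.mpr (Or.inl h)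
  exact o.symm.strictMono this

end PartiteSystem

/-- Embeddings of ordered structures with an `L`-valued binary relation. -/
def RelOrdEmb {L : Type} {a b : ℕ} (A : Fin a → Fin a → L) (B : Fin b → Fin b → L)
    (f : Fin a → Fin b) : Prop :=
  StrictMono f ∧ ∀ i j, B (f i) (f j) = A i j

open PartiteSystem in
/-- The Ramsey property of finite ordered structures with an `L`-valued binary relation,
for finitely many structures of the same size at once. -/
theorem exists_ramsey_relOrdEmb {L Λ : Type} [Finite Λ] {a b : ℕ}
    (A : Λ → Fin a → Fin a → L) (B : Fin b → Fin b → L) (κ : Type) [Finite κ]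
    [Nonempty κ] :
    ∃ (c : ℕ) (C : Fin c → Fin c → L), ∀ α : (Fin a → Fin c) → κ,
      ∃ e, RelOrdEmb B C e ∧ ∀ x, ∃ d, ∀ f, RelOrdEmb (A x) B f → α (e ∘ f) = d := by
  classical
  have := Fintype.ofFinite Λ
  obtain ⟨p, hp⟩ := exists_homogeneous_strictMono (Λ → κ) a b
  let V : PartiteSystem L (Fin p) :=
    { carrier := {g : Fin b → Fin p // StrictMono g} × Fin b
      finite := inferInstance
      proj := fun v => v.1.1 v.2
      rel := fun u v => B u.2 v.2 }
  obtain ⟨W, hW⟩ := exists_mono_over_finset A κ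
    (Finset.univ.filter fun q : Λ × (Fin a → Fin p) => StrictMono q.2)
    (fun q hq => (Finset.mem_filter.mp hq).2.injective) V
  obtain ⟨c, ε, hε⟩ := W.exists_enumeration
  refine ⟨c, fun i j => W.rel (ε.symm i) (ε.symm j), fun α => ?_⟩
  obtain ⟨φ, hφ, hφS⟩ := hW fun f => α (ε ∘ f)
  have hcol : ∀ s : Fin a → Fin p, ∀ x, ∃ d, StrictMono s →
      ∀ f, IsCopyOver (A x) s V f → α (ε ∘ φ ∘ f) = d := by
    intro s x
    by_cases hs : StrictMono s
    · obtain ⟨d, hd⟩ := hφS (x, s) (by simpa using hs)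
      exact ⟨d, fun _ => hd⟩
    · exact ⟨Classical.arbitrary κ, fun h => (hs h).elim⟩
  choose col hcol using hcol
  obtain ⟨g, hg, hgc⟩ := hp col
  refine ⟨fun i => ε (φ (⟨g, hg⟩, i)), ⟨fun i j hij => hε _ _ ?_, fun i j => ?_⟩, fun x => ?_⟩
  · rw [hφ.1, hφ.1]
    exact hg hij
  · simp only [Equiv.symm_apply_apply]
    rw [hφ.2]
  · have key : ∀ f, RelOrdEmb (A x) B f →
        α ((fun i => ε (φ (⟨g, hg⟩, i))) ∘ f) = col (g ∘ f) x := fun f hf =>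
      hcol (g ∘ f) x (hg.comp hf.1) (fun i => (⟨g, hg⟩, f i)) ⟨fun _ => rfl, hf.2⟩
    by_cases h : ∃ f, RelOrdEmb (A x) B f
    · obtain ⟨f₀, hf₀⟩ := h
      exact ⟨col (g ∘ f₀) x, fun f hf =>
        (key f hf).trans (congrFun (hgc f f₀ hf.1 hf₀.1) x)⟩
    · exact ⟨Classical.arbitrary κ, fun f hf => (h ⟨f, hf⟩).elim⟩

theorem OrdEmb.colorable {a c m : ℕ} {X : SimpleGraph (Fin a)} {Z : SimpleGraph (Fin c)}
    {f : Fin a → Fin c} (hf : OrdEmb X Z f) (hZ : Z.Colorable m) : X.Colorable m :=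
  hZ.of_hom (⟨f, fun h => (hf.2 _ _).mpr h⟩ : X →g Z)

/-- The upper bound for the Ramsey degree. -/
theorem exists_few_colors {n a b : ℕ} (X : SimpleGraph (Fin a)) (Y : SimpleGraph (Fin b))
    (hY : Y.Colorable n) (κ : Type) [Finite κ] [Nonempty κ] :
    ∃ (c : ℕ) (Z : SimpleGraph (Fin c)), Z.Colorable n ∧
      ∀ α : (Fin a → Fin c) → κ, ∃ e : Fin b → Fin c, OrdEmb Y Z e ∧
        ∃ V : Finset κ, V.card ≤ Nat.card {lam : Fin a → Fin n // ProperCol X lam} ∧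
          ∀ f : Fin a → Fin b, OrdEmb X Y f → α (e ∘ f) ∈ V := by
  classical
  obtain ⟨μ⟩ := hY
  obtain ⟨c, C, hC⟩ := exists_ramsey_relOrdEmb
    (fun (x : {lam : Fin a → Fin n // ProperCol X lam}) i j => (X.Adj i j, x.1 i))
    (fun i j => (Y.Adj i j, μ i)) κ
  let Z : SimpleGraph (Fin c) :=
    { Adj := fun u v => (C u v).1 ∧ (C v u).1 ∧ (C u u).2 ≠ (C v v).2
      symm := ⟨fun _ _ h => ⟨h.2.1, h.1, h.2.2.symm⟩⟩
      loopless := ⟨fun _ h => h.2.2 rfl⟩ }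
  refine ⟨c, Z, ⟨SimpleGraph.Coloring.mk (fun u => (C u u).2) fun h => h.2.2⟩, fun α => ?_⟩
  obtain ⟨e, he, hd⟩ := hC α
  choose d hd using hd
  refine ⟨e, ⟨he.1, fun i j => ?_⟩, Finset.univ.image d, ?_, fun f hf => ?_⟩
  · change (C _ _).1 ∧ (C _ _).1 ∧ (C _ _).2 ≠ (C _ _).2 ↔ _
    rw [he.2, he.2, he.2, he.2]
    exact ⟨fun h => h.1, fun h => ⟨h, h.symm, μ.valid h⟩⟩
  · rw [Nat.card_eq_fintype_card]
    exact Finset.card_image_le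
  · have hp : ProperCol X fun i => μ (f i) := fun i j h => μ.valid ((hf.2 i j).mpr h)
    refine Finset.mem_image.mpr
      ⟨⟨_, hp⟩, Finset.mem_univ _, (hd ⟨_, hp⟩ f ⟨hf.1, fun i j => ?_⟩).symm⟩
    simp only [hf.2]

/-- The disjoint union of one copy of `X` for each proper coloring, together with a clique
on the set of colors, where a vertex of color `i` is joined to all clique vertices but `i`. -/
def rigidGraph {n a : ℕ} (X : SimpleGraph (Fin a)) :
    SimpleGraph (({lam : Fin a → Fin n // ProperCol X lam} × Fin a) ⊕ Fin n) where
  Adj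
    | .inl x, .inl y => x.1 = y.1 ∧ X.Adj x.2 y.2
    | .inl x, .inr j => x.1.1 x.2 ≠ j
    | .inr j, .inl x => x.1.1 x.2 ≠ j
    | .inr i, .inr j => i ≠ j
  symm := ⟨by
    rintro (x | i) (y | j) h
    · exact ⟨h.1.symm, h.2.symm⟩
    · exact h
    · exact h
    · exact Ne.symm h⟩
  loopless := ⟨by
    rintro (x | i) h
    · exact X.loopless.irrefl _ h.2
    · exact h rfl⟩

theorem rigidGraph_colorable {n a : ℕ} (X : SimpleGraph (Fin a)) :
    (rigidGraph (n := n) X).Colorable n := by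
  refine ⟨SimpleGraph.Coloring.mk (Sum.elim (fun x => x.1.1 x.2) id) ?_⟩
  rintro (⟨l, i⟩ | i) (⟨l', j⟩ | j) h
  · obtain ⟨rfl, h⟩ := h
    exact l.2 _ _ h
  · exact h
  · exact Ne.symm h
  · exact h

/-- Every proper coloring of the rigid graph is the standard one up to a permutation. -/
theorem rigidGraph_coloring {n a : ℕ} {X : SimpleGraph (Fin a)}
    (γ : (rigidGraph (n := n) X).Coloring (Fin n)) :
    ∃ π : Equiv.Perm (Fin n), ∀ l i, γ (.inl (l, i)) = π (l.1 i) := by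
  have hinj : Function.Injective fun j : Fin n => γ (.inr j) := by
    intro i j h
    by_contra hij
    exact γ.valid (show (rigidGraph X).Adj (.inr i) (.inr j) from hij) h
  refine ⟨Equiv.ofBijective _ (Finite.injective_iff_bijective.mp hinj), fun l i => ?_⟩
  obtain ⟨j, hj⟩ := (Finite.injective_iff_surjective.mp hinj) (γ (.inl (l, i)))
  have : l.1 i = j := by
    by_contra h
    exact γ.valid (show (rigidGraph X).Adj (.inl (l, i)) (.inr j) from h) hj.symm
  rw [← hj, this]
  rfl

/-- There is an `n`-chromatic ordered graph all of whose proper colorings induce every proper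
coloring of `X` on some copy of `X`. -/
theorem exists_all_colorings {n a : ℕ} (X : SimpleGraph (Fin a)) (hX : X.Colorable n) :
    ∃ (b : ℕ) (Y : SimpleGraph (Fin b)), Y.Colorable n ∧ (∃ f, OrdEmb X Y f) ∧
      ∀ γ : Y.Coloring (Fin n), ∀ lam : Fin a → Fin n, ProperCol X lam →
        ∃ f, OrdEmb X Y f ∧ ∀ i, γ (f i) = lam i := by
  let W : PartiteSystem Unit ℕ :=
    { carrier := ({lam : Fin a → Fin n // ProperCol X lam} × Fin a) ⊕ Fin n
      finite := inferInstance
      proj := Sum.elim (fun x => x.2) fun _ => 0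
      rel := fun _ _ => () }
  obtain ⟨b, ε, hε⟩ := W.exists_enumeration
  let Y : SimpleGraph (Fin b) := (rigidGraph (n := n) X).comap ε.symm
  have emb : ∀ l, OrdEmb X Y fun i => ε (.inl (l, i)) := fun l =>
    ⟨fun i j h => hε _ _ h, fun i j => by
      change (rigidGraph X).Adj (ε.symm (ε _)) (ε.symm (ε _)) ↔ _
      rw [Equiv.symm_apply_apply, Equiv.symm_apply_apply]
      exact ⟨fun h => h.2, fun h => ⟨rfl, h⟩⟩⟩
  refine ⟨b, Y, (rigidGraph_colorable X).of_hom (SimpleGraph.Hom.comap ε.symm _), ?_,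
    fun γ lam hlam => ?_⟩
  · obtain ⟨μ⟩ := hX
    exact ⟨_, emb ⟨μ, fun _ _ h => μ.valid h⟩⟩
  · obtain ⟨π, hπ⟩ := rigidGraph_coloring (X := X)
      (SimpleGraph.Coloring.mk (fun u => γ (ε u)) fun {u v} h => γ.valid (by
        change (rigidGraph X).Adj (ε.symm (ε u)) (ε.symm (ε v))
        rwa [Equiv.symm_apply_apply, Equiv.symm_apply_apply]))
    refine ⟨_, emb ⟨fun i => π.symm (lam i), fun i j h => π.symm.injective.ne (hlam i j h)⟩,
      fun i => (hπ _ i).trans (π.apply_symm_apply _)⟩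

/-- every finite ordered `n`-chromatic graph `X` has Ramsey degree in
`χ^<_n` equal to `σ(X)`, the number of non-isomorphic extensions of `X` in `K^<_n`. -/
theorem stmt_6 (n : ℕ) (hn : 1 ≤ n) (a : ℕ)
    (X : SimpleGraph (Fin a)) (hX : X.Colorable n ∧ ¬ X.Colorable (n - 1)) :
    IsLeast {t : ℕ |
      ∀ (b : ℕ) (Y : SimpleGraph (Fin b)), (Y.Colorable n ∧ ¬ Y.Colorable (n - 1)) →
        ∀ k : ℕ, ∃ (c : ℕ) (Z : SimpleGraph (Fin c)),
          (Z.Colorable n ∧ ¬ Z.Colorable (n - 1)) ∧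
          ∀ α : (Fin a → Fin c) → Fin k,
            ∃ e : Fin b → Fin c, OrdEmb Y Z e ∧
              ∃ V : Finset (Fin k), V.card ≤ t ∧
                ∀ f : Fin a → Fin b, OrdEmb X Y f → α (e ∘ f) ∈ V}
      (Nat.card {lam : Fin a → Fin n // ProperCol X lam}) := by
  classical
  obtain ⟨hXn, hXn'⟩ := hX
  constructor
  · rintro b Y ⟨hY, hY'⟩ k
    obtain rfl | hk := Nat.eq_zero_or_pos k
    · have hb : Nonempty (Fin b) := by
        by_contra h
        have := not_nonempty_iff.mp h
        exact hY' (.of_isEmpty _)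
      exact ⟨b, Y, ⟨hY, hY'⟩, fun α => (α fun _ => hb.some).elim0⟩
    · have : Nonempty (Fin k) := ⟨⟨0, hk⟩⟩
      obtain ⟨c, Z, hZ, hα⟩ := exists_few_colors (n := n) X Y hY (Fin k)
      obtain ⟨e, he, -⟩ := hα fun _ => ⟨0, hk⟩
      exact ⟨c, Z, ⟨hZ, fun h => hY' (he.colorable h)⟩, hα⟩
  · intro t ht
    obtain ⟨b, Y, hY, ⟨f₀, hf₀⟩, hcol⟩ := exists_all_colorings X hXn
    obtain ⟨c, Z, ⟨⟨γ⟩, -⟩, hα⟩ := ht b Y ⟨hY, fun h => hXn' (hf₀.colorable h)⟩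
      (Nat.card {lam : Fin a → Fin n // ProperCol X lam})
    let E := Finite.equivFin {lam : Fin a → Fin n // ProperCol X lam}
    obtain ⟨μ⟩ := hXn
    obtain ⟨e, he, V, hV, hmem⟩ := hα fun g =>
      if h : ProperCol X fun i => γ (g i) then E ⟨_, h⟩ else E ⟨μ, fun _ _ h => μ.valid h⟩
    have hVuniv : V = Finset.univ := by
      refine Finset.eq_univ_of_forall fun x => ?_
      obtain ⟨⟨lam, hlam⟩, rfl⟩ := E.surjective x
      obtain ⟨f, hf, hfc⟩ := hcol
        (SimpleGraph.Coloring.mk (fun u => γ (e u)) fun {u v} h => γ.valid ((he.2 u v).mpr h))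
        lam hlam
      have hfl : (fun i => γ ((e ∘ f) i)) = lam := funext hfc
      have := hmem f hf
      simp only [hfl] at this
      rwa [dif_pos hlam] at this
    rwa [hVuniv, Finset.card_univ, Fintype.card_fin] at hV
end

section
/- Fix an integer n ≥ 1 and let Ŷ ∈ K^<_n contain a copy of the complete graph on n vertices. Then there exists Ẑ ∈ K^<_n such that for every proper coloring λ : Ẑ → {1,…,n} of the underlying graph of Ẑ, there is a copy Ỹ of Ŷ in Ẑ and a permutation f of {1,…,n} such that λ = f ∘ λ^Ỹ on the vertex set of Ỹ, where λ^Ỹ is the built-in coloring of the copy Ỹ. -/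
/-- Every coloring of a long enough chain is constant on a subchain of prescribed length. -/
theorem exists_strictMono_monochromatic (n b : ℕ) (c : Fin (n * b + 1) → Fin n) :
    ∃ (φ : Fin b → Fin (n * b + 1)) (k : Fin n), StrictMono φ ∧ ∀ y, c (φ y) = k := by
  obtain ⟨k, hk⟩ := Fintype.exists_lt_card_fiber_of_mul_lt_card (f := c) (n := b) (by simp)
  refine ⟨Finset.orderEmbOfCardLe _ hk.le, k, OrderEmbedding.strictMono _, fun y => ?_⟩
  simpa using Finset.orderEmbOfCardLe_mem _ hk.le y

/-- Composition of embeddings of ordered colored graphs. -/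
theorem ColOrdEmb.comp {n a b c : ℕ} {X : SimpleGraph (Fin a)} {lamX : Fin a → Fin n}
    {Y : SimpleGraph (Fin b)} {lamY : Fin b → Fin n} {Z : SimpleGraph (Fin c)}
    {lamZ : Fin c → Fin n} {g : Fin b → Fin c} {f : Fin a → Fin b}
    (hg : ColOrdEmb Y lamY Z lamZ g) (hf : ColOrdEmb X lamX Y lamY f) :
    ColOrdEmb X lamX Z lamZ (g ∘ f) :=
  ⟨⟨hg.1.1.comp hf.1.1, fun i j => (hg.1.2 _ _).trans (hf.1.2 i j)⟩,
    fun i => (hg.2 _).trans (hf.2 i)⟩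

/-- Vertices of color `i` are shared by all the copies of `Y` placed along the chain `Fin M`,
the remaining ones carry the name `φ` of their copy. -/
def chainCopy {n b M : ℕ} (lamY : Fin b → Fin n) (i : Fin n) (φ : Fin b → Fin M) (y : Fin b) :
    Fin M ×ₗ WithBot (Lex (Fin b → Fin M)) :=
  toLex (φ y, if lamY y = i then ⊥ else ((toLex φ : Lex (Fin b → Fin M)) : WithBot _))

theorem chainCopy_strictMono {n b M : ℕ} (lamY : Fin b → Fin n) (i : Fin n)
    {φ : Fin b → Fin M} (hφ : StrictMono φ) : StrictMono (chainCopy lamY i φ) :=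
  fun _ _ h => Prod.Lex.toLex_lt_toLex.2 (Or.inl (hφ h))

theorem chainCopy_of_eq {n b M : ℕ} {lamY : Fin b → Fin n} {i : Fin n} (φ : Fin b → Fin M)
    {y : Fin b} (h : lamY y = i) : chainCopy lamY i φ y = toLex (φ y, ⊥) := by
  simp [chainCopy, h]

theorem color_eq_of_chainCopy_eq {n b M : ℕ} {lamY : Fin b → Fin n} {i : Fin n}
    {φ ψ : Fin b → Fin M} {y z : Fin b}
    (h : chainCopy lamY i φ y = chainCopy lamY i ψ z) (hz : lamY z = i) : lamY y = i := by
  by_contra hy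
  have := congrArg Prod.snd (toLex_inj.1 h)
  simp [hy, hz] at this

theorem eq_of_chainCopy_eq {n b M : ℕ} {lamY : Fin b → Fin n} {i : Fin n}
    {φ ψ : Fin b → Fin M} {y z : Fin b}
    (h : chainCopy lamY i φ y = chainCopy lamY i ψ z) (hz : lamY z ≠ i) : φ = ψ := by
  have hy : lamY y ≠ i := fun hy => hz (color_eq_of_chainCopy_eq h.symm hy)
  have := congrArg Prod.snd (toLex_inj.1 h)
  simpa [hy, hz] using this

/-- Vertex partition property for a single color class. -/
theorem exists_monochromatic_class {n b : ℕ} (Y : SimpleGraph (Fin b)) (lamY : Fin b → Fin n)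
    (hY : ProperCol Y lamY) (i : Fin n) :
    ∃ (c : ℕ) (Z : SimpleGraph (Fin c)) (lamZ : Fin c → Fin n), ProperCol Z lamZ ∧
      ∀ lam : Fin c → Fin n, ∃ e : Fin b → Fin c, ColOrdEmb Y lamY Z lamZ e ∧
        ∃ k, ∀ y, lamY y = i → lam (e y) = k := by
  classical
  let M := n * b + 1
  let V := Fin M ×ₗ WithBot (Lex (Fin b → Fin M))
  have : Finite (Lex (Fin b → Fin M)) := inferInstanceAs (Finite (Fin b → Fin M))
  have : Finite (WithBot (Lex (Fin b → Fin M))) :=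
    inferInstanceAs (Finite (Option (Lex (Fin b → Fin M))))
  have : Finite V := inferInstanceAs (Finite (Fin M × WithBot (Lex (Fin b → Fin M))))
  let _ : Fintype V := Fintype.ofFinite V
  let o : Fin (Fintype.card V) ≃o V := Fintype.orderIsoFinOfCardEq V rfl
  let A : V → V → Prop := fun x x' => ∃ φ y y', StrictMono φ ∧ Y.Adj y y' ∧
    chainCopy lamY i φ y = x ∧ chainCopy lamY i φ y' = x'
  let col : V → Fin n := fun x =>
    if h : ∃ y φ, StrictMono φ ∧ chainCopy lamY i φ y = x then lamY h.choose else i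
  have hcol : ∀ φ y, StrictMono φ → col (chainCopy lamY i φ y) = lamY y := by
    intro φ y hφ
    have h : ∃ z ψ, StrictMono ψ ∧ chainCopy lamY i ψ z = chainCopy lamY i φ y :=
      ⟨y, φ, hφ, rfl⟩
    simp only [col, dif_pos h]
    obtain ⟨ψ, hψ, he⟩ := h.choose_spec
    by_cases hy : lamY y = i
    · rw [color_eq_of_chainCopy_eq he hy, hy]
    · obtain rfl := eq_of_chainCopy_eq he hy
      rw [(chainCopy_strictMono lamY i hψ).injective he]
  have hA : ∀ x x', A x x' → col x ≠ col x' := by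
    rintro _ _ ⟨φ, y, y', hφ, hadj, rfl, rfl⟩
    rw [hcol φ y hφ, hcol φ y' hφ]
    exact hY y y' hadj
  have hind : ∀ φ y y', StrictMono φ →
      (A (chainCopy lamY i φ y) (chainCopy lamY i φ y') ↔ Y.Adj y y') := by
    intro φ y y' hφ
    refine ⟨?_, fun h => ⟨φ, y, y', hφ, h, rfl, rfl⟩⟩
    rintro ⟨ψ, z, z', hψ, hadj, h, h'⟩
    have hφψ : φ = ψ := by
      by_cases hz : lamY z = i
      · exact eq_of_chainCopy_eq h'.symm fun hz' => hY z z' hadj (hz.trans hz'.symm)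
      · exact eq_of_chainCopy_eq h.symm hz
    subst hφψ
    have hinj := (chainCopy_strictMono lamY i hφ).injective
    rwa [← hinj h, ← hinj h']
  let Z : SimpleGraph (Fin (Fintype.card V)) :=
    { Adj := fun p q => A (o p) (o q)
      symm := ⟨fun p q ⟨φ, y, y', hφ, h, h1, h2⟩ => ⟨φ, y', y, hφ, h.symm, h2, h1⟩⟩
      loopless := ⟨fun p h => hA _ _ h rfl⟩ }
  refine ⟨_, Z, fun p => col (o p), fun p q h => hA _ _ h, fun lam => ?_⟩
  obtain ⟨φ, k, hφ, hk⟩ :=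
    exists_strictMono_monochromatic n b fun p => lam (o.symm (toLex (p, ⊥)))
  refine ⟨fun y => o.symm (chainCopy lamY i φ y),
    ⟨⟨o.symm.strictMono.comp (chainCopy_strictMono lamY i hφ), fun y y' => ?_⟩, fun y => ?_⟩,
    k, fun y hy => ?_⟩
  · simpa [Z] using hind φ y y' hφ
  · simpa using hcol φ y hφ
  · simpa [chainCopy_of_eq φ hy] using hk y

/-- Vertex partition property for several color classes simultaneously. -/
theorem exists_monochromatic_classes {n : ℕ} (s : Finset (Fin n)) :
    ∀ {b : ℕ} (Y : SimpleGraph (Fin b)) (lamY : Fin b → Fin n), ProperCol Y lamY →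
    ∃ (c : ℕ) (Z : SimpleGraph (Fin c)) (lamZ : Fin c → Fin n), ProperCol Z lamZ ∧
      ∀ lam : Fin c → Fin n, ∃ e : Fin b → Fin c, ColOrdEmb Y lamY Z lamZ e ∧
        ∀ i ∈ s, ∃ k, ∀ y, lamY y = i → lam (e y) = k := by
  induction s using Finset.induction_on with
  | empty =>
    intro b Y lamY hY
    exact ⟨b, Y, lamY, hY, fun _ => ⟨id, ⟨⟨strictMono_id, fun _ _ => Iff.rfl⟩, fun _ => rfl⟩,
      by simp⟩⟩
  | insert i s _ ih =>
    intro b Y lamY hY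
    obtain ⟨c, Z, lamZ, hZ, h⟩ := exists_monochromatic_class Y lamY hY i
    obtain ⟨d, T, lamT, hT, h'⟩ := ih Z lamZ hZ
    refine ⟨d, T, lamT, hT, fun lam => ?_⟩
    obtain ⟨g, hg, hgs⟩ := h' lam
    obtain ⟨e, he, k, hk⟩ := h (lam ∘ g)
    refine ⟨g ∘ e, hg.comp he, fun j hj => ?_⟩
    rcases Finset.mem_insert.1 hj with rfl | hj
    · exact ⟨k, hk⟩
    · obtain ⟨l, hl⟩ := hgs j hj
      exact ⟨l, fun y hy => hl (e y) ((he.2 y).trans hy)⟩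

/-- if `(Y, lamY) ∈ K^<_n` contains a copy of the complete graph on
`n` vertices, there is `(Z, lamZ) ∈ K^<_n` such that for every proper `[n]`-coloring
`lam` of `Z` there is a copy of `(Y, lamY)` in `(Z, lamZ)` on which `lam` agrees
with `f ∘ lamY` for some permutation `f` of the colors. -/
theorem stmt_8 (n : ℕ) (hn : 1 ≤ n) (b : ℕ)
    (Y : SimpleGraph (Fin b)) (lamY : Fin b → Fin n) (hY : ProperCol Y lamY)
    (hK : ∃ g : Fin n → Fin b, Function.Injective g ∧
      ∀ i j, i ≠ j → Y.Adj (g i) (g j)) :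
    ∃ (c : ℕ) (Z : SimpleGraph (Fin c)) (lamZ : Fin c → Fin n),
      ProperCol Z lamZ ∧
      ∀ lam : Fin c → Fin n, ProperCol Z lam →
        ∃ (e : Fin b → Fin c) (f : Equiv.Perm (Fin n)),
          ColOrdEmb Y lamY Z lamZ e ∧ ∀ i, lam (e i) = f (lamY i) := by
  obtain ⟨c, Z, lamZ, hZ, h⟩ := exists_monochromatic_classes Finset.univ Y lamY hY
  refine ⟨c, Z, lamZ, hZ, fun lam hlam => ?_⟩
  obtain ⟨e, he, hmono⟩ := h lam
  choose f hf using fun i => hmono i (Finset.mem_univ i)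
  obtain ⟨g, -, hg⟩ := hK
  have hfg : Function.Injective (f ∘ lamY ∘ g) := by
    intro i j hij
    by_contra hne
    refine hlam _ _ ((he.1.2 _ _).2 (hg i j hne)) ?_
    rw [hf _ _ rfl, hf _ _ rfl]
    exact hij
  have hfs : Function.Surjective f := (Finite.surjective_of_injective hfg).of_comp
  exact ⟨e, Equiv.ofBijective f (Finite.surjective_iff_bijective.1 hfs), he,
    fun y => hf _ y rfl⟩
end

section
/- Fix an integer n ≥ 1. The class M^<_n of all monotone finite ordered [n]-colored graphs has the Ramsey property: for all X̂, Ŷ ∈ M^<_n and every k ∈ ℕ there exists Ẑ ∈ M^<_n such that for every map α from the copies of X̂ in Ẑ to {1,…,k} there is a copy Ỹ of Ŷ in Ẑ on whose copies of X̂ the map α is constant. -/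
open Finset in
/-- An intermediate form of Ramsey's theorem: if the theorem holds for `a`-sets, then every large
finite set has a large subset in which the color of an `(a+1)`-set depends only on its minimum. -/
theorem exists_min_homogeneous {κ : Type} {a : ℕ}
    (ih : ∀ b : ℕ, ∃ N : ℕ, ∀ (T : Type) [LinearOrder T] (S : Finset T), N ≤ #S →
      ∀ α : Finset T → κ, ∃ H ⊆ S, #H = b ∧ ∃ c, ∀ U ⊆ H, #U = a → α U = c) (m : ℕ) :
    ∃ N : ℕ, ∀ (T : Type) [LinearOrder T] (S : Finset T), N ≤ #S →
      ∀ α : Finset T → κ, ∃ H ⊆ S, #H = m ∧ ∃ c : T → κ, ∀ U ⊆ H, #U = a →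
        ∀ x ∈ H, (∀ y ∈ U, x < y) → α (insert x U) = c x := by
  induction m with
  | zero => exact ⟨0, fun T _ S _ α => ⟨∅, by simp, by simp, fun x => α {x}, by simp⟩⟩
  | succ m ihm =>
    obtain ⟨N₁, h₁⟩ := ihm
    obtain ⟨N₂, h₂⟩ := ih N₁
    refine ⟨N₂ + 1, fun T _ S hS α => ?_⟩
    have hne : S.Nonempty := card_pos.1 (by omega)
    have hx₀ := S.min'_mem hne
    set x₀ := S.min' hne with hx₀_def
    obtain ⟨H₁, hH₁, hcard₁, c₀, hc₀⟩ := h₂ T (S.erase x₀)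
      (by rw [card_erase_of_mem hx₀]; omega) (fun U => α (insert x₀ U))
    obtain ⟨H₂, hH₂, hcard₂, c, hc⟩ := h₁ T H₁ hcard₁.ge α
    have hlt : ∀ y ∈ H₂, x₀ < y := fun y hy => by
      have hy' := hH₁ (hH₂ hy)
      exact lt_of_le_of_ne (S.min'_le y (mem_of_mem_erase hy')) (ne_of_mem_erase hy').symm
    have hnot : x₀ ∉ H₂ := fun h => lt_irrefl _ (hlt _ h)
    refine ⟨insert x₀ H₂, ?_, by rw [card_insert_of_notMem hnot, hcard₂],
      Function.update c x₀ c₀, ?_⟩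
    · exact insert_subset hx₀ ((hH₂.trans hH₁).trans (erase_subset _ _))
    · intro U hU hUa x hx hxU
      have hU' : U ⊆ H₂ := by
        refine (subset_insert_iff_of_notMem fun h₀ => ?_).1 hU
        rcases mem_insert.1 hx with rfl | hx'
        · exact lt_irrefl _ (hxU _ h₀)
        · exact lt_asymm (hlt x hx') (hxU _ h₀)
      rcases mem_insert.1 hx with rfl | hx'
      · rw [Function.update_self]
        exact hc₀ U (hU'.trans hH₂) hUa
      · rw [Function.update_of_ne (hlt x hx').ne']
        exact hc U hU' hUa x hx' hxU

open Finset in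
/-- The finite **Ramsey theorem** for `a`-element sets and finitely many colors. -/
theorem finite_ramsey (κ : Type) [Finite κ] (a : ℕ) : ∀ b : ℕ, ∃ N : ℕ,
    ∀ (T : Type) [LinearOrder T] (S : Finset T), N ≤ #S →
      ∀ α : Finset T → κ, ∃ H ⊆ S, #H = b ∧ ∃ c, ∀ U ⊆ H, #U = a → α U = c := by
  induction a with
  | zero =>
    refine fun b => ⟨b, fun T _ S hS α => ?_⟩
    obtain ⟨H, hH, hb⟩ := exists_subset_card_eq hS
    exact ⟨H, hH, hb, α ∅, fun U _ hU => by rw [card_eq_zero.1 hU]⟩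
  | succ a ih =>
    intro b
    classical
    have := Fintype.ofFinite κ
    obtain ⟨N, hN⟩ := exists_min_homogeneous ih (Fintype.card κ * b)
    refine ⟨N, fun T _ S hS α => ?_⟩
    obtain ⟨H, hHS, hH, c, hc⟩ := hN T S hS α
    obtain ⟨y, -, hy⟩ := exists_le_card_fiber_of_mul_le_card_of_maps_to
      (s := H) (t := univ) (f := c) (n := b) (fun _ _ => mem_univ _) ⟨α ∅, mem_univ _⟩
      (by rw [card_univ, hH])
    obtain ⟨H', hH', hb⟩ := exists_subset_card_eq hy
    have hsub : H' ⊆ H := hH'.trans (filter_subset _ _)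
    refine ⟨H', hsub.trans hHS, hb, y, fun U hU hUa => ?_⟩
    have hne : U.Nonempty := card_pos.1 (by omega)
    have hmem := U.min'_mem hne
    rw [← insert_erase hmem, hc _ ((erase_subset _ _).trans (hU.trans hsub))
      (by rw [card_erase_of_mem hmem]; omega) _ (hsub (hU hmem))
      fun z hz => U.min'_lt_of_mem_erase_min' hne hz]
    exact (mem_filter.1 (hH' (hU hmem))).2

/-- The finite Ramsey theorem for increasing tuples. -/
theorem finite_ramsey_strictMono (κ : Type) [Finite κ] [Nonempty κ] (a b : ℕ) :
    ∃ p : ℕ, ∀ c : (Fin a → Fin p) → κ, ∃ τ : Fin b → Fin p, StrictMono τ ∧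
      ∃ d, ∀ f : Fin a → Fin b, StrictMono f → c (τ ∘ f) = d := by
  classical
  obtain ⟨p, hp⟩ := finite_ramsey κ a b
  refine ⟨p, fun c => ?_⟩
  obtain ⟨H, -, hH, d, hd⟩ := hp (Fin p) Finset.univ (by simp) fun U =>
    if h : U.card = a then c (U.orderEmbOfFin h) else Classical.arbitrary κ
  refine ⟨H.orderEmbOfFin hH, (H.orderEmbOfFin hH).strictMono, d, fun f hf => ?_⟩
  have hmono : StrictMono (H.orderEmbOfFin hH ∘ f) := (H.orderEmbOfFin hH).strictMono.comp hf
  have hcard : (Finset.univ.image (H.orderEmbOfFin hH ∘ f)).card = a := by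
    rw [Finset.card_image_of_injective _ hmono.injective, Finset.card_univ, Fintype.card_fin]
  have key := hd _ (fun z hz => by
    obtain ⟨x, -, rfl⟩ := Finset.mem_image.1 hz
    exact H.orderEmbOfFin_mem hH (f x)) hcard
  rw [dif_pos hcard, ← Finset.orderEmbOfFin_unique hcard
    (fun x => Finset.mem_image_of_mem _ (Finset.mem_univ x)) hmono] at key
  exact key

/-- The partite power of `G` with respect to the graph `X`: over an edge of `X` adjacency is
required in all coordinates, over a non-edge in some coordinate. -/
def partitePower {A V : Type} (X : SimpleGraph A) (G : SimpleGraph V) (ι : Type) :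
    SimpleGraph (A × (ι → V)) where
  Adj u v := (X.Adj u.1 v.1 ∧ ∀ j, G.Adj (u.2 j) (v.2 j)) ∨
    (¬ X.Adj u.1 v.1 ∧ ∃ j, G.Adj (u.2 j) (v.2 j))
  symm := ⟨fun u v h => by simpa only [X.adj_comm, G.adj_comm] using h⟩
  loopless := ⟨fun u h => by simp at h⟩

/-- Free amalgamation: copies of `G` indexed by `L` can be glued to a graph `C`, each along an
embedding of the subgraph of `G` induced by `P`, so that every copy of `G` remains induced. -/
theorem exists_amalgam {V W L : Type} (G : SimpleGraph V) (C : SimpleGraph W) (P : V → Prop)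
    (h : L → V → W) (h_inj : ∀ l x y, P x → P y → h l x = h l y → x = y)
    (h_adj : ∀ l x y, P x → P y → (C.Adj (h l x) (h l y) ↔ G.Adj x y)) :
    ∃ (G' : SimpleGraph (W ⊕ L × V)) (e : L → V → W ⊕ L × V),
      (∀ l x, P x → e l x = .inl (h l x)) ∧ (∀ l x, ¬ P x → e l x = .inr (l, x)) ∧
      ∀ l x y, G'.Adj (e l x) (e l y) ↔ G.Adj x y := by
  classical
  let e : L → V → W ⊕ L × V := fun l x => if P x then .inl (h l x) else .inr (l, x)
  have he : ∀ l x, P x → e l x = .inl (h l x) := fun l x hx => if_pos hx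
  have he' : ∀ l x, ¬ P x → e l x = .inr (l, x) := fun l x hx => if_neg hx
  have e_eq : ∀ l l' x x', e l x = e l' x' →
      (P x ∧ P x' ∧ h l x = h l' x') ∨ (l = l' ∧ x = x') := by
    intro l l' x x' hxx
    by_cases hx : P x <;> by_cases hx' : P x' <;> simp [e, hx, hx'] at hxx
    exacts [.inl ⟨hx, hx', hxx⟩, .inr hxx]
  have e_inj : ∀ l, Function.Injective (e l) := fun l x x' hxx => by
    rcases e_eq l l x x' hxx with ⟨hx, hx', hh⟩ | ⟨-, hh⟩
    exacts [h_inj l x x' hx hx' hh, hh]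
  let emb : L → V ↪ W ⊕ L × V := fun l => ⟨e l, e_inj l⟩
  refine ⟨C.map (Function.Embedding.inl : W ↪ W ⊕ L × V) ⊔ ⨆ l, G.map (emb l),
    e, he, he', fun l x y => ?_⟩
  simp only [SimpleGraph.sup_adj, SimpleGraph.iSup_adj, SimpleGraph.map_adj,
    Function.Embedding.inl_apply]
  constructor
  · rintro (⟨u, v, huv, hu, hv⟩ | ⟨l', x', y', hxy, hx, hy⟩)
    · by_cases hPx : P x
      · by_cases hPy : P y
        · rw [he l x hPx, Sum.inl.injEq] at hu
          rw [he l y hPy, Sum.inl.injEq] at hv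
          exact (h_adj l x y hPx hPy).1 (by rwa [← hu, ← hv])
        · simp [he' l y hPy] at hv
      · simp [he' l x hPx] at hu
    · rcases e_eq _ _ _ _ hx with ⟨hPx', hPx, hx'⟩ | ⟨rfl, rfl⟩
      · rcases e_eq _ _ _ _ hy with ⟨hPy', hPy, hy'⟩ | ⟨rfl, rfl⟩
        · rw [← h_adj l x y hPx hPy, ← hx', ← hy', h_adj l' x' y' hPx' hPy']
          exact hxy
        · rwa [← e_inj _ hx]
      · rwa [← e_inj _ hy]
  · exact fun hxy => .inr ⟨l, x, y, hxy, rfl, rfl⟩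

/-- `s` is an induced copy of `X` in `G` lying over `σ` with respect to the projection `π`. -/
def IsCopyOver {A B V : Type} (X : SimpleGraph A) (G : SimpleGraph V) (π : V → B) (σ : A → B)
    (s : A → V) : Prop :=
  (∀ i j, G.Adj (s i) (s j) ↔ X.Adj i j) ∧ ∀ i, π (s i) = σ i

open Combinatorics in
/-- One step of the partite construction, making all copies of `X` over a fixed `σ`
monochromatic. -/
theorem exists_partite_step {A B V κ : Type} [Finite A] [Finite B] [Finite V] [Finite κ]
    [Nonempty κ] (X : SimpleGraph A) (G : SimpleGraph V) (π : V → B) (σ : A ↪ B) :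
    ∃ (V' : Type) (_ : Finite V') (G' : SimpleGraph V') (π' : V' → B),
      ∀ α : (A → V') → κ, ∃ e : V → V',
        (∀ x y, G'.Adj (e x) (e y) ↔ G.Adj x y) ∧ (∀ x, π' (e x) = π x) ∧
        ∃ c, ∀ s, IsCopyOver X G π σ s → α (e ∘ s) = c := by
  obtain ⟨ι, _, hι⟩ := Line.exists_mono_in_high_dimension {s // IsCopyOver X G π σ s} κ
  have : Finite (Line {s // IsCopyOver X G π σ s} ι) :=
    Finite.of_injective Line.idxFun fun _ _ => Line.ext
  let h : Line {s // IsCopyOver X G π σ s} ι → V → B × (ι → V) := fun l x =>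
    (π x, fun j => (l.idxFun j).elim x fun s => Function.extend σ s.1 (fun _ => x) (π x))
  have h_eq : ∀ l x i, π x = σ i → h l x = (σ i, fun j => (l.idxFun j).elim x fun s => s.1 i) :=
    fun l x i hx => by simp only [h, hx, σ.injective.extend_apply]
  have h_inj : ∀ l x y, (∃ i, π x = σ i) → (∃ i, π y = σ i) → h l x = h l y → x = y := by
    rintro l x y ⟨i, hx⟩ ⟨i', hy⟩ hxy
    obtain ⟨j, hj⟩ := l.proper
    simpa [h, hj] using congrFun (congrArg Prod.snd hxy) j
  have h_adj : ∀ l x y, (∃ i, π x = σ i) → (∃ i, π y = σ i) →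
      ((partitePower (X.map σ) G ι).Adj (h l x) (h l y) ↔ G.Adj x y) := by
    rintro l x y ⟨i, hx⟩ ⟨i', hy⟩
    obtain ⟨j, hj⟩ := l.proper
    rw [h_eq l x i hx, h_eq l y i' hy]
    simp only [partitePower, SimpleGraph.map_adj_apply]
    constructor
    · rintro (⟨-, hall⟩ | ⟨hX, j', hj'⟩)
      · simpa [hj] using hall j
      · cases hs : l.idxFun j' with
        | none => simpa [hs] using hj'
        | some s => exact absurd ((s.2.1 i i').1 (by simpa [hs] using hj')) hX
    · intro hxy
      by_cases hX : X.Adj i i'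
      · refine .inl ⟨hX, fun j' => ?_⟩
        cases l.idxFun j' with
        | none => exact hxy
        | some s => exact (s.2.1 i i').2 hX
      · exact .inr ⟨hX, j, by simpa [hj] using hxy⟩
  obtain ⟨G', e, he, he', heG⟩ := exists_amalgam G (partitePower (X.map σ) G ι)
    (fun x => ∃ i, π x = σ i) h h_inj h_adj
  refine ⟨_, inferInstance, G', Sum.elim Prod.fst fun x => π x.2, fun α => ?_⟩
  obtain ⟨l, c, hc⟩ := hι fun w => α fun i => .inl (σ i, fun j => (w j).1 i)
  refine ⟨e l, heG l, fun x => ?_, c, fun s hs => ?_⟩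
  · by_cases hx : ∃ i, π x = σ i
    · rw [he l x hx]; rfl
    · rw [he' l x hx]; rfl
  · rw [← hc ⟨s, hs⟩]
    congr 1
    funext i
    rw [Function.comp_apply, he l _ ⟨i, hs.2 i⟩, h_eq l _ i (hs.2 i)]
    congr 2
    funext j
    rw [Line.coe_apply]
    cases l.idxFun j <;> rfl

/-- The partite construction: there is an extension of `G` in which, for each `σ ∈ F`, the color of
a copy of `X` over `σ` inside a suitable copy of `G` depends only on `σ`. -/
theorem exists_partite_construction {A B V κ : Type} [Finite A] [Finite B] [Finite V] [Finite κ]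
    [Nonempty κ] (X : SimpleGraph A) (G : SimpleGraph V) (π : V → B) (F : Finset (A ↪ B)) :
    ∃ (V' : Type) (_ : Finite V') (G' : SimpleGraph V') (π' : V' → B),
      ∀ α : (A → V') → κ, ∃ e : V → V',
        (∀ x y, G'.Adj (e x) (e y) ↔ G.Adj x y) ∧ (∀ x, π' (e x) = π x) ∧
        ∀ σ ∈ F, ∃ c, ∀ s, IsCopyOver X G π σ s → α (e ∘ s) = c := by
  classical
  induction F using Finset.induction_on with
  | empty => exact ⟨V, ‹_›, G, π, fun α => ⟨id, by simp⟩⟩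
  | insert σ F _ ih =>
    obtain ⟨V₁, _, G₁, π₁, h₁⟩ := ih
    obtain ⟨V₂, hV₂, G₂, π₂, h₂⟩ := exists_partite_step (κ := κ) X G₁ π₁ σ
    refine ⟨V₂, hV₂, G₂, π₂, fun α => ?_⟩
    obtain ⟨e₂, he₂, hπ₂, c, hc⟩ := h₂ α
    obtain ⟨e₁, he₁, hπ₁, hF⟩ := h₁ fun s => α (e₂ ∘ s)
    refine ⟨e₂ ∘ e₁, fun x y => (he₂ _ _).trans (he₁ x y), fun x => (hπ₂ _).trans (hπ₁ x), ?_⟩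
    intro σ' hσ'
    rcases Finset.mem_insert.1 hσ' with rfl | hσ'
    · exact ⟨c, fun s hs => hc (e₁ ∘ s)
        ⟨fun i j => (he₁ _ _).trans (hs.1 i j), fun i => (hπ₁ _).trans (hs.2 i)⟩⟩
    · exact hF σ' hσ'

/-- The Ramsey property of finite ordered graphs, in a form where the ordering of the large graph
is given by a projection `π` to a finite linear order. -/
theorem exists_ordered_ramsey (κ : Type) [Finite κ] [Nonempty κ] {a b : ℕ}
    (X : SimpleGraph (Fin a)) (Y : SimpleGraph (Fin b)) :
    ∃ (p : ℕ) (V : Type) (_ : Finite V) (G : SimpleGraph V) (π : V → Fin p),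
      ∀ α : (Fin a → V) → κ, ∃ e : Fin b → V,
        (∀ i j, G.Adj (e i) (e j) ↔ Y.Adj i j) ∧ StrictMono (π ∘ e) ∧
        ∃ d, ∀ f : Fin a → Fin b, OrdEmb X Y f → α (e ∘ f) = d := by
  classical
  obtain ⟨p, hp⟩ := finite_ramsey_strictMono κ a b
  let G₀ : SimpleGraph ((Fin b → Fin p) × Fin b) :=
    { Adj u v := u.1 = v.1 ∧ Y.Adj u.2 v.2
      symm := ⟨fun u v h => ⟨h.1.symm, h.2.symm⟩⟩
      loopless := ⟨fun u h => Y.irrefl h.2⟩ }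
  obtain ⟨V, hV, G, π, h⟩ := exists_partite_construction (κ := κ) X G₀ (fun u => u.1 u.2)
    (Finset.univ : Finset (Fin a ↪ Fin p))
  refine ⟨p, V, hV, G, π, fun α => ?_⟩
  obtain ⟨e, he, hπ, hc⟩ := h α
  choose c hc using fun σ => hc σ (Finset.mem_univ σ)
  obtain ⟨τ, hτ, d, hd⟩ := hp fun σ =>
    if hσ : Function.Injective σ then c ⟨σ, hσ⟩ else Classical.arbitrary κ
  refine ⟨fun y => e (τ, y), fun i j => (he _ _).trans (by simp [G₀]), fun i j hij => ?_, d,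
    fun f hf => ?_⟩
  · simpa only [Function.comp_apply, hπ] using hτ hij
  · rw [← hd f hf.1, dif_pos (hτ.comp hf.1).injective]
    exact hc _ (fun x => (τ, f x)) ⟨fun i j => by simpa [G₀] using hf.2 i j, fun i => rfl⟩

/-- the class `M^<_n` of monotone finite ordered `[n]`-colored graphs
has the Ramsey property. -/
theorem stmt_9 (n : ℕ) (hn : 1 ≤ n) (a b : ℕ)
    (X : SimpleGraph (Fin a)) (lamX : Fin a → Fin n)
    (hX : ProperCol X lamX) (hXm : Monotone lamX)
    (Y : SimpleGraph (Fin b)) (lamY : Fin b → Fin n)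
    (hY : ProperCol Y lamY) (hYm : Monotone lamY) (k : ℕ) :
    ∃ (c : ℕ) (Z : SimpleGraph (Fin c)) (lamZ : Fin c → Fin n),
      ProperCol Z lamZ ∧ Monotone lamZ ∧
      ∀ α : (Fin a → Fin c) → Fin k,
        ∃ e : Fin b → Fin c, ColOrdEmb Y lamY Z lamZ e ∧
          ∀ f g : Fin a → Fin b, ColOrdEmb X lamX Y lamY f →
            ColOrdEmb X lamX Y lamY g → α (e ∘ f) = α (e ∘ g) := by
  rcases Nat.eq_zero_or_pos k with rfl | hk
  · exact ⟨1, ⊥, fun _ => ⟨0, hn⟩, by simp [ProperCol], monotone_const,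
      fun α => (α fun _ => 0).elim0⟩
  have : Nonempty (Fin k) := ⟨⟨0, hk⟩⟩
  obtain ⟨p, V, _, G, π, hG⟩ := exists_ordered_ramsey (Fin k) X Y
  obtain ⟨m, ⟨ν⟩⟩ := Finite.exists_equiv_fin V
  let o := Fintype.orderIsoFinOfCardEq (Fin n ×ₗ (Fin p ×ₗ Fin m)) rfl |>.symm
  have ho : ∀ u, o.symm (o u) = u := o.symm_apply_apply
  let vert : Fin n → V → Fin n ×ₗ (Fin p ×ₗ Fin m) := fun i v => toLex (i, toLex (π v, ν v))
  let Z : SimpleGraph (Fin n ×ₗ (Fin p ×ₗ Fin m)) :=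
    { Adj u v := (ofLex u).1 ≠ (ofLex v).1 ∧
        G.Adj (ν.symm (ofLex (ofLex u).2).2) (ν.symm (ofLex (ofLex v).2).2)
      symm := ⟨fun u v h => ⟨h.1.symm, h.2.symm⟩⟩
      loopless := ⟨fun u h => h.1 rfl⟩ }
  refine ⟨_, Z.comap o.symm, fun z => (ofLex (o.symm z)).1, fun i j h => h.1, fun i j hij => ?_,
    fun α => ?_⟩
  · exact Prod.Lex.monotone_fst _ _ (o.symm.monotone hij)
  obtain ⟨e, he, hπ, d, hd⟩ := hG fun s => α fun x => o (vert (lamX x) (s x))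
  refine ⟨fun y => o (vert (lamY y) (e y)), ⟨⟨fun i j hij => ?_, fun i j => ?_⟩, fun i => ?_⟩, ?_⟩
  · refine o.strictMono (Prod.Lex.toLex_lt_toLex.2 ?_)
    rcases (hYm hij.le).lt_or_eq with h | h
    · exact .inl h
    · exact .inr ⟨h, Prod.Lex.toLex_lt_toLex.2 (.inl (hπ hij))⟩
  · simp only [SimpleGraph.comap_adj, Z, ho, vert, ofLex_toLex, Equiv.symm_apply_apply, he]
    exact and_iff_right_of_imp (hY i j)
  · simp only [ho, vert, ofLex_toLex]
  · have key : ∀ f, ColOrdEmb X lamX Y lamY f →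
        α ((fun y => o (vert (lamY y) (e y))) ∘ f) = d := fun f hf => by
      rw [← hd f hf.1]
      congr 1
      funext x
      simp only [Function.comp_apply, hf.2 x]
    exact fun f g hf hg => (key f hf).trans (key g hg).symm
end

section
/- Fix an integer n ≥ 1, let X̂, Ŷ ∈ M^<_n with the coloring λ^Ŷ attaining all values in {1,…,n}, let k ∈ ℕ, and let Ẑ = (Ẑ, E^Ẑ, <^Ẑ, λ^Ẑ) ∈ K^<_n satisfy Ẑ → (Ŷ)^X̂_k. Then there exists a linear ordering <* on the vertex set of Ẑ that coincides with <^Ẑ on each λ^Ẑ-color class and such that Ẑ* := (Ẑ, E^Ẑ, <*, λ^Ẑ) belongs to M^<_n and satisfies Ẑ* → (Ŷ)^X̂_k. -/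
/-- if `(Z, lamZ) ∈ K^<_n` satisfies `Z → (Y)^X_k` for monotone
`X, Y ∈ M^<_n` with `lamY` onto, then there is a linear ordering `lt` on the
vertices of `Z` coinciding with the original order on each color class, making
the structure monotone, and still satisfying the arrow relation. -/
theorem stmt_10 (n : ℕ) (hn : 1 ≤ n) (a b c : ℕ)
    (X : SimpleGraph (Fin a)) (lamX : Fin a → Fin n)
    (hX : ProperCol X lamX) (hXm : Monotone lamX)
    (Y : SimpleGraph (Fin b)) (lamY : Fin b → Fin n)
    (hY : ProperCol Y lamY) (hYm : Monotone lamY)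
    (hYall : Function.Surjective lamY)
    (k : ℕ)
    (Z : SimpleGraph (Fin c)) (lamZ : Fin c → Fin n) (hZ : ProperCol Z lamZ)
    (hArrow : ∀ α : (Fin a → Fin c) → Fin k,
      ∃ e : Fin b → Fin c, ColOrdEmb Y lamY Z lamZ e ∧
        ∀ f g : Fin a → Fin b, ColOrdEmb X lamX Y lamY f →
          ColOrdEmb X lamX Y lamY g → α (e ∘ f) = α (e ∘ g)) :
    ∃ lt : Fin c → Fin c → Prop, IsStrictTotalOrder (Fin c) lt ∧
      (∀ i j, lamZ i = lamZ j → (lt i j ↔ i < j)) ∧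
      (∀ i j, lt i j → lamZ i ≤ lamZ j) ∧
      ∀ α : (Fin a → Fin c) → Fin k,
        ∃ e : Fin b → Fin c,
          ((∀ i j, i < j → lt (e i) (e j)) ∧
            (∀ i j, Z.Adj (e i) (e j) ↔ Y.Adj i j) ∧
            (∀ i, lamZ (e i) = lamY i)) ∧
          ∀ f g : Fin a → Fin b, ColOrdEmb X lamX Y lamY f →
            ColOrdEmb X lamX Y lamY g → α (e ∘ f) = α (e ∘ g) := by
  refine ⟨fun i j => lamZ i < lamZ j ∨ (lamZ i = lamZ j ∧ i < j), ?_, ?_, ?_, ?_⟩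
  · exact
      { trichotomous := by
          intro i j
          rcases lt_trichotomy (lamZ i) (lamZ j) with h | h | h <;>
            rcases lt_trichotomy i j with h' | h' | h' <;> simp_all
        irrefl := by simp
        trans := by
          rintro i j l (h | ⟨h, h'⟩) (g | ⟨g, g'⟩)
          · exact Or.inl (h.trans g)
          · exact Or.inl (g ▸ h)
          · exact Or.inl (h ▸ g)
          · exact Or.inr ⟨h.trans g, h'.trans g'⟩ }
  · intro i j h
    simp [h]
  · rintro i j (h | ⟨h, -⟩)
    · exact h.le
    · exact h.le
  · intro α
    obtain ⟨e, ⟨⟨he, hadj⟩, hcol⟩, hα⟩ := hArrow α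
    refine ⟨e, ⟨fun i j hij => ?_, hadj, hcol⟩, hα⟩
    simp only [hcol]
    exact (hYm hij.le).lt_or_eq.imp id fun h => ⟨h, he hij⟩
end

section
/- Fix an integer n ≥ 1. Every element X of the class C_n of all finite n-colorable graphs has a finite Ramsey degree in C_n equal to τ(X), the number of non-isomorphic extensions of X in M^<_n. That is: τ(X) is the least natural number t such that for every Y ∈ C_n and every k ∈ ℕ there exists Z ∈ C_n such that for every map α from the copies of X in Z to {1,…,k} there is a copy Ỹ of Y in Z such that α takes at most t values on the copies of X in Ỹ. -/
/-- `τ(X)`: the number of non-isomorphic extensions of the (unordered) graph `X`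
in `M^<_n`, i.e. the number of structures on `Fin a` (with its natural order)
whose graph is isomorphic to `X`, equipped with a monotone proper `[n]`-coloring. -/
noncomputable def TauNum (n : ℕ) {a : ℕ} (X : SimpleGraph (Fin a)) : ℕ :=
  Nat.card {p : SimpleGraph (Fin a) × (Fin a → Fin n) //
    Nonempty (p.1 ≃g X) ∧ ProperCol p.1 p.2 ∧ Monotone p.2}

open Function in
/-- Partite lemma: one pattern of injective partial transversals can be made monochromatic. -/
theorem exists_partite_mono {I V J κ : Type} [Finite I] [Finite V] [Finite J] [Finite κ]
    {R : SimpleGraph I} {G : SimpleGraph V} (π : G →g R)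
    (A : SimpleGraph J) (e : J → I) (he : Injective e) :
    ∃ (V' : Type) (_ : Finite V') (G' : SimpleGraph V') (π' : G' →g R),
      ∀ χ : (J → V') → κ, ∃ Φ : G ↪g G', (∀ v, π' (Φ v) = π v) ∧
        ∃ c, ∀ f : J → V, π ∘ f = e → G.comap f = A → χ (Φ ∘ f) = c := by
  classical
  let F := {f : J → V // π ∘ f = e ∧ G.comap f = A}
  obtain ⟨ι, _, hι⟩ := Combinatorics.Line.exists_mono_in_high_dimension F κ
  let E : Option V → Option V → Prop := fun o o' => ∃ u ∈ o, ∃ v ∈ o', G.Adj u v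
  have hE : ∀ o o', E o o' → E o' o := fun o o' ⟨u, hu, v, hv, h⟩ => ⟨v, hv, u, hu, h.symm⟩
  let T : I → I → Prop := fun i j => ∃ s t, e s = i ∧ e t = j ∧ A.Adj s t
  have hT : ∀ i j, T i j → T j i := fun i j ⟨s, t, hs, ht, h⟩ => ⟨t, s, ht, hs, h.symm⟩
  let G' : SimpleGraph (I × (ι → Option V)) :=
    { Adj := fun x y => R.Adj x.1 y.1 ∧
        (T x.1 y.1 → ∀ m, E (x.2 m) (y.2 m)) ∧ (¬ T x.1 y.1 → ∃ m, E (x.2 m) (y.2 m))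
      symm := ⟨fun x y ⟨h1, h2, h3⟩ => ⟨h1.symm, fun h m => hE _ _ (h2 (hT _ _ h) m),
        fun h => (h3 fun h' => h (hT _ _ h')).imp fun m => hE _ _⟩⟩
      loopless := ⟨fun x h => R.loopless.irrefl _ h.1⟩ }
  let π' : G' →g R := ⟨Prod.fst, fun h => h.1⟩
  refine ⟨I × (ι → Option V), inferInstance, G', π', fun χ => ?_⟩
  obtain ⟨L, c, hc⟩ := hι fun x : ι → F => χ fun s => (e s, fun m => some ((x m).1 s))
  obtain ⟨m₀, hm₀⟩ := L.proper
  let fill : ι → V → Option V := fun m v =>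
    (L.idxFun m).elim (some v) fun g => extend e (fun s => some (g.1 s)) (fun _ => none) (π v)
  have fill_none : ∀ m v, L.idxFun m = none → fill m v = some v := by
    intro m v h; simp [fill, h]
  have fill_some : ∀ m v g s, L.idxFun m = some g → π v = e s → fill m v = some (g.1 s) := by
    intro m v g s h hs
    simp only [fill, h, Option.elim_some, hs]
    exact he.extend_apply _ _ _
  have fill_out : ∀ m v g, L.idxFun m = some g → (¬ ∃ s, e s = π v) → fill m v = none := by
    intro m v g h hs
    simp only [fill, h, Option.elim_some]
    exact extend_apply' _ _ _ hs
  have E_some : ∀ u v, E (some u) (some v) ↔ G.Adj u v := by simp [E]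
  have adj_of : ∀ (g : F) s t, G.Adj (g.1 s) (g.1 t) ↔ A.Adj s t := by
    exact fun g s t => iff_of_eq (congrArg (fun H : SimpleGraph J => H.Adj s t) g.2.2)
  let Φ₀ : V → I × (ι → Option V) := fun v => (π v, fun m => fill m v)
  have hinj : Injective Φ₀ := by
    intro u v h
    have := congrFun (congrArg Prod.snd h) m₀
    simpa [Φ₀, fill_none _ _ hm₀] using this
  have hadj : ∀ u v, G'.Adj (Φ₀ u) (Φ₀ v) ↔ G.Adj u v := by
    intro u v
    constructor
    · rintro ⟨-, h2, h3⟩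
      by_cases h : T (π u) (π v)
      · have := h2 h m₀
        simpa [Φ₀, fill_none _ _ hm₀, E_some] using this
      · obtain ⟨m, hm⟩ := h3 h
        change E (fill m u) (fill m v) at hm
        cases hL : L.idxFun m with
        | none => simpa [fill_none _ _ hL, E_some] using hm
        | some g =>
          exfalso
          by_cases hu : ∃ s, e s = π u
          · by_cases hv : ∃ s, e s = π v
            · obtain ⟨s, hs⟩ := hu
              obtain ⟨t, ht⟩ := hv
              rw [fill_some m u g s hL hs.symm, fill_some m v g t hL ht.symm, E_some, adj_of] at hm
              exact h ⟨s, t, hs, ht, hm⟩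
            · rw [fill_out m v g hL hv] at hm
              simp [E] at hm
          · rw [fill_out m u g hL hu] at hm
            simp [E] at hm
    · intro h
      refine ⟨π.map_adj h, fun hT' m => ?_, fun _ => ⟨m₀, ?_⟩⟩
      · obtain ⟨s, t, hs, ht, hst⟩ := hT'
        change E (fill m u) (fill m v)
        cases hL : L.idxFun m with
        | none => simpa [fill_none _ _ hL, E_some] using h
        | some g =>
          rw [fill_some m u g s hL hs.symm, fill_some m v g t hL ht.symm, E_some, adj_of]
          exact hst
      · change E (fill m₀ u) (fill m₀ v)
        simpa [fill_none _ _ hm₀, E_some] using h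
  refine ⟨⟨⟨Φ₀, hinj⟩, fun {u v} => hadj u v⟩, fun v => rfl, c, fun f hf hA => ?_⟩
  rw [← hc ⟨f, hf, hA⟩]
  congr 1
  funext s
  have hs : π (f s) = e s := congrFun hf s
  refine Prod.ext hs (funext fun m => ?_)
  change fill m (f s) = some _
  cases hL : L.idxFun m with
  | none => rw [fill_none _ _ hL, Combinatorics.Line.apply_none _ _ _ hL]
  | some g => rw [fill_some m (f s) g s hL hs, Combinatorics.Line.apply_some hL]

open Function in
theorem exists_partite_mono_list {I J κ : Type} [Finite I] [Finite J] [Finite κ]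
    {R : SimpleGraph I} (l : List (SimpleGraph J × {e : J → I // Injective e})) :
    ∀ {V : Type} [Finite V] {G : SimpleGraph V} (π : G →g R),
    ∃ (V' : Type) (_ : Finite V') (G' : SimpleGraph V') (π' : G' →g R),
      ∀ χ : (J → V') → κ, ∃ Φ : G ↪g G', (∀ v, π' (Φ v) = π v) ∧
        ∀ p ∈ l, ∃ c, ∀ f : J → V, π ∘ f = p.2.1 → G.comap f = p.1 → χ (Φ ∘ f) = c := by
  induction l with
  | nil =>
    intro V _ G π
    exact ⟨V, inferInstance, G, π, fun χ => ⟨SimpleGraph.Embedding.refl, fun _ => rfl, by simp⟩⟩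
  | cons p l ih =>
    intro V _ G π
    obtain ⟨V₁, _, G₁, π₁, h₁⟩ := exists_partite_mono (κ := κ) π p.1 p.2.1 p.2.2
    obtain ⟨V₂, _, G₂, π₂, h₂⟩ := ih π₁
    refine ⟨V₂, inferInstance, G₂, π₂, fun χ => ?_⟩
    obtain ⟨Φ₂, hπ₂, hl⟩ := h₂ χ
    obtain ⟨Φ₁, hπ₁, hp⟩ := h₁ fun f => χ (Φ₂ ∘ f)
    refine ⟨Φ₂.comp Φ₁, fun v => (hπ₂ _).trans (hπ₁ v), ?_⟩
    intro q hq
    rcases List.mem_cons.1 hq with rfl | hq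
    · exact hp
    · obtain ⟨c, hc⟩ := hl q hq
      refine ⟨c, fun f hf hA => hc (Φ₁ ∘ f) ?_ ?_⟩
      · rw [← hf]; funext s; exact hπ₁ _
      · rw [← hA]; ext s t; exact Φ₁.map_adj_iff

open Function in
/-- Iterated partite construction: the colour of an injective partial transversal depends only
on its projection and its induced graph. -/
theorem exists_partite_ramsey {I V J κ : Type} [Finite I] [Finite V] [Finite J] [Finite κ]
    {R : SimpleGraph I} {G : SimpleGraph V} (π : G →g R) :
    ∃ (V' : Type) (_ : Finite V') (G' : SimpleGraph V') (π' : G' →g R),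
      ∀ χ : (J → V') → κ, ∃ Φ : G ↪g G', (∀ v, π' (Φ v) = π v) ∧
        ∀ f g : J → V, Injective (π ∘ f) → π ∘ f = π ∘ g → G.comap f = G.comap g →
          χ (Φ ∘ f) = χ (Φ ∘ g) := by
  classical
  have := Fintype.ofFinite (SimpleGraph J × {e : J → I // Injective e})
  obtain ⟨V', hV', G', π', h⟩ := exists_partite_mono_list (κ := κ)
    (Finset.univ : Finset (SimpleGraph J × {e : J → I // Injective e})).toList π
  refine ⟨V', hV', G', π', fun χ => ?_⟩
  obtain ⟨Φ, hπ, hΦ⟩ := h χ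
  refine ⟨Φ, hπ, fun f g hf hfg hG => ?_⟩
  obtain ⟨c, hc⟩ := hΦ (G.comap f, ⟨π ∘ f, hf⟩) (by simp)
  rw [hc f rfl rfl, hc g hfg.symm hG.symm]

/-- A coloring of finsets becomes, on a large subset, a function of the least element. -/
theorem Finset.exists_min_determined {κ : Type} {a : ℕ} [Nonempty κ]
    (ih : ∀ b, ∃ p, ∀ (α : Type) [LinearOrder α] (S : Finset α), p ≤ S.card →
      ∀ χ : Finset α → κ, ∃ T ⊆ S, T.card = b ∧ ∃ c, ∀ U ⊆ T, U.card = a → χ U = c) (m : ℕ) :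
    ∃ p, ∀ (α : Type) [LinearOrder α] (S : Finset α), p ≤ S.card →
      ∀ χ : Finset α → κ, ∃ T ⊆ S, T.card = m ∧ ∃ d : α → κ,
        ∀ U ⊆ T, U.card = a → ∀ x ∈ T, (∀ u ∈ U, x < u) → χ (insert x U) = d x := by
  classical
  induction m with
  | zero =>
    refine ⟨0, fun α _ S _ χ => ⟨∅, by simp, by simp, fun _ => Classical.arbitrary κ, ?_⟩⟩
    simp
  | succ m hm =>
    obtain ⟨q, hq⟩ := hm
    obtain ⟨r, hr⟩ := ih q
    refine ⟨r + 1, fun α _ S hS χ => ?_⟩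
    have hne : S.Nonempty := Finset.card_pos.1 (by omega)
    set x := S.min' hne with hx
    have hxS : x ∈ S := S.min'_mem hne
    obtain ⟨T', hT'S, hT'card, c, hc⟩ := hr α (S.erase x)
      (by rw [Finset.card_erase_of_mem hxS]; omega) fun U => χ (insert x U)
    obtain ⟨T, hTT', hTcard, d, hd⟩ := hq α T' hT'card.ge χ
    have hlt : ∀ y ∈ T, x < y := fun y hy => S.min'_lt_of_mem_erase_min' hne (hT'S (hTT' hy))
    have hxT : x ∉ T := fun h => (hlt x h).false
    refine ⟨insert x T, ?_, by rw [Finset.card_insert_of_notMem hxT, hTcard],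
      fun y => if y = x then c else d y, ?_⟩
    · exact Finset.insert_subset hxS ((hTT'.trans hT'S).trans (Finset.erase_subset _ _))
    · intro U hU hUc y hy hyU
      have hxU : x ∉ U := by
        intro h
        have := hyU x h
        rcases Finset.mem_insert.1 hy with rfl | hy
        · exact this.false
        · exact (this.trans (hlt y hy)).false
      have hUT : U ⊆ T := (Finset.subset_insert_iff_of_notMem hxU).1 hU
      rcases Finset.mem_insert.1 hy with hyx | hy
      · simp only [hyx, if_true]
        exact hc U (hUT.trans hTT') hUc
      · simp only [(hlt y hy).ne', if_false]
        exact hd U hUT hUc y hy hyU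

/-- The finite Ramsey theorem. -/
theorem Finset.exists_ramsey (κ : Type) [Finite κ] [Nonempty κ] (a : ℕ) : ∀ b, ∃ p,
    ∀ (α : Type) [LinearOrder α] (S : Finset α), p ≤ S.card →
      ∀ χ : Finset α → κ, ∃ T ⊆ S, T.card = b ∧ ∃ c, ∀ U ⊆ T, U.card = a → χ U = c := by
  classical
  have := Fintype.ofFinite κ
  induction a with
  | zero =>
    intro b
    refine ⟨b, fun α _ S hS χ => ?_⟩
    obtain ⟨T, hT, hc⟩ := Finset.exists_subset_card_eq hS
    refine ⟨T, hT, hc, χ ∅, fun U _ hU => ?_⟩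
    rw [Finset.card_eq_zero.1 hU]
  | succ a ih =>
    intro b
    obtain ⟨p, hp⟩ := Finset.exists_min_determined ih (Fintype.card κ * b)
    refine ⟨p, fun α _ S hS χ => ?_⟩
    obtain ⟨T, hTS, hTc, d, hd⟩ := hp α S hS χ
    obtain ⟨c, -, hc⟩ := Finset.exists_le_card_fiber_of_mul_le_card_of_maps_to (s := T)
      (t := Finset.univ) (f := d) (n := b) (fun _ _ => Finset.mem_univ _) Finset.univ_nonempty
      (by rw [hTc, Finset.card_univ])
    obtain ⟨T', hT', hT'c⟩ := Finset.exists_subset_card_eq hc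
    have hT'T : T' ⊆ T := hT'.trans (Finset.filter_subset _ _)
    refine ⟨T', hT'T.trans hTS, hT'c, c, fun U hU hUc => ?_⟩
    have hne : U.Nonempty := Finset.card_pos.1 (by omega)
    have hmem := U.min'_mem hne
    rw [← Finset.insert_erase hmem, hd (U.erase (U.min' hne))
      ((Finset.erase_subset _ _).trans (hU.trans hT'T))
      (by rw [Finset.card_erase_of_mem hmem]; omega) _ (hT'T (hU hmem))
      (fun u hu => U.min'_lt_of_mem_erase_min' hne hu)]
    exact (Finset.mem_filter.1 (hT' (hU hmem))).2

open Function in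
/-- Ramsey theorem for ordered colored graphs, for all patterns of size `a` at once. -/
theorem exists_colored_ramsey {n a : ℕ} {W κ : Type} [LinearOrder W] [Fintype W] [Finite κ]
    [Nonempty κ] (B : SimpleGraph W) (lam : W → Fin n) (hlam : ∀ u v, B.Adj u v → lam u ≠ lam v) :
    ∃ (V : Type) (_ : Finite V) (C : SimpleGraph V) (lamC : V → Fin n),
      (∀ u v, C.Adj u v → lamC u ≠ lamC v) ∧
      ∀ χ : (Fin a → V) → κ, ∃ Ψ : B ↪g C, (∀ x, lamC (Ψ x) = lam x) ∧
        ∀ f g : Fin a → W, StrictMono f → StrictMono g → B.comap f = B.comap g →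
          lam ∘ f = lam ∘ g → χ (Ψ ∘ f) = χ (Ψ ∘ g) := by
  classical
  obtain ⟨p, hp⟩ := Finset.exists_ramsey (SimpleGraph (Fin a) × (Fin a → Fin n) → κ) a
    (Fintype.card W)
  let R : SimpleGraph (Fin p × Fin n) :=
    { Adj := fun x y => x.2 ≠ y.2
      symm := ⟨fun x y h => h.symm⟩
      loopless := ⟨fun x h => h rfl⟩ }
  let G : SimpleGraph ((W → Fin p) × W) :=
    { Adj := fun x y => x.1 = y.1 ∧ B.Adj x.2 y.2
      symm := ⟨fun x y h => ⟨h.1.symm, h.2.symm⟩⟩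
      loopless := ⟨fun x h => B.loopless.irrefl _ h.2⟩ }
  let π : G →g R := ⟨fun x => (x.1 x.2, lam x.2), fun h => hlam _ _ h.2⟩
  obtain ⟨V, hV, C, πC, hC⟩ := exists_partite_ramsey (J := Fin a) (κ := κ) π
  refine ⟨V, hV, C, fun v => (πC v).2, fun u v h => πC.map_adj h, fun χ => ?_⟩
  obtain ⟨Φ, hΦπ, hΦ⟩ := hC χ
  let Q : Finset (Fin p) → SimpleGraph (Fin a) × (Fin a → Fin n) →
      (Fin a → (W → Fin p) × W) → Prop := fun U t f =>
    StrictMono (fun s => (π (f s)).1) ∧ Finset.univ.image (fun s => (π (f s)).1) = U ∧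
      G.comap f = t.1 ∧ (fun s => (π (f s)).2) = t.2
  let χ' : Finset (Fin p) → SimpleGraph (Fin a) × (Fin a → Fin n) → κ := fun U t =>
    if h : ∃ f, Q U t f then χ (Φ ∘ h.choose) else Classical.arbitrary κ
  have key : ∀ U t f, Q U t f → χ' U t = χ (Φ ∘ f) := by
    intro U t f hf
    have h : ∃ f, Q U t f := ⟨f, hf⟩
    obtain ⟨h1, h2, h3, h4⟩ := h.choose_spec
    obtain ⟨k1, k2, k3, k4⟩ := hf
    simp only [χ', dif_pos h]
    have h5 : (fun s => (π (h.choose s)).1) = fun s => (π (f s)).1 := by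
      refine (h1.range_inj k1).1 ?_
      have := congrArg (fun s : Finset (Fin p) => (s : Set (Fin p))) (h2.trans k2.symm)
      simpa using this
    refine hΦ _ _ (fun s t hst => h1.injective (congrArg Prod.fst hst)) ?_ (h3.trans k3.symm)
    funext s
    exact Prod.ext (congrFun h5 s) (congrFun (h4.trans k4.symm) s)
  obtain ⟨T, -, hTc, c, hc⟩ := hp (Fin p) Finset.univ (by simp) χ'
  let h : W → Fin p := fun w => T.orderEmbOfFin hTc ((Fintype.orderIsoFinOfCardEq W rfl).symm w)
  have hmono : StrictMono h := (T.orderEmbOfFin hTc).strictMono.comp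
    (Fintype.orderIsoFinOfCardEq W rfl).symm.strictMono
  have hmem : ∀ w, h w ∈ T := fun w => T.orderEmbOfFin_mem hTc _
  let j : B ↪g G := ⟨⟨fun w => (h, w), fun u v huv => congrArg Prod.snd huv⟩, fun {u v} => and_iff_right rfl⟩
  have col : ∀ f : Fin a → W, StrictMono f → χ (Φ ∘ j ∘ f) = c (B.comap f, lam ∘ f) := by
    intro f hf
    have hU : χ' (Finset.univ.image (h ∘ f)) = c := by
      refine hc _ ?_ ?_
      · intro x hx
        obtain ⟨s, -, rfl⟩ := Finset.mem_image.1 hx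
        exact hmem _
      · rw [Finset.card_image_of_injective _ (hmono.comp hf).injective, Finset.card_univ,
          Fintype.card_fin]
    rw [← hU]
    refine (key _ _ (j ∘ f) ⟨hmono.comp hf, rfl, ?_, rfl⟩).symm
    ext s t
    exact j.map_adj_iff
  refine ⟨Φ.comp j, fun x => congrArg Prod.snd (hΦπ (j x)), fun f g hf hg hfg hl => ?_⟩
  have hf' := col f hf
  have hg' := col g hg
  rw [hfg, hl] at hf'
  exact hf'.trans hg'.symm

open Function in
theorem SimpleGraph.nonempty_comap_iso_of_range_eq {V J : Type*} (G : SimpleGraph V) {f g : J → V}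
    (hf : Injective f) (hg : Injective g) (h : Set.range f = Set.range g) :
    Nonempty (G.comap f ≃g G.comap g) := by
  let e : J ≃ J := (Equiv.ofInjective f hf).trans
    ((Equiv.setCongr h).trans (Equiv.ofInjective g hg).symm)
  have he : ∀ s, g (e s) = f s := fun s => Equiv.apply_ofInjective_symm hg _
  exact ⟨⟨e, fun {s t} => by simp only [SimpleGraph.comap_adj, he]⟩⟩

/-- The extensions of `X` in `M^<_n`, counted by `TauNum`. -/
abbrev MonotoneExtension (n : ℕ) {a : ℕ} (X : SimpleGraph (Fin a)) : Type :=
  {p : SimpleGraph (Fin a) × (Fin a → Fin n) //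
    Nonempty (p.1 ≃g X) ∧ ProperCol p.1 p.2 ∧ Monotone p.2}

open Function in
theorem exists_graph_few_values {n a b k : ℕ} (X : SimpleGraph (Fin a)) (Y : SimpleGraph (Fin b))
    (hY : Y.Colorable n) :
    ∃ (c : ℕ) (Z : SimpleGraph (Fin c)), Z.Colorable n ∧
      ∀ α : Finset (Fin c) → Fin k, ∃ T : Finset (Fin c), IsCopy Y Z T ∧
        ∃ V : Finset (Fin k), V.card ≤ TauNum n X ∧
          ∀ S : Finset (Fin c), S ⊆ T → IsCopy X Z S → α S ∈ V := by
  classical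
  rcases Nat.eq_zero_or_pos k with rfl | hk
  · exact ⟨b, Y, hY, fun α => (α ∅).elim0⟩
  have : Nonempty (Fin k) := ⟨⟨0, hk⟩⟩
  obtain ⟨col⟩ := hY
  let ρ : Equiv.Perm (Fin b) := Tuple.sort col
  have hρ : Monotone (col ∘ ρ) := Tuple.monotone_sort col
  let B := Y.comap ρ
  have hB : ∀ u v, B.Adj u v → (col ∘ ρ) u ≠ (col ∘ ρ) v := fun u v h => col.valid h
  obtain ⟨W, _, C, lamC, hC, hram⟩ := exists_colored_ramsey (a := a) (κ := Fin k) B (col ∘ ρ) hB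
  have := Fintype.ofFinite W
  let e : W ≃ Fin (Fintype.card W) := Fintype.equivFin W
  refine ⟨Fintype.card W, C.comap e.symm,
    ⟨SimpleGraph.Coloring.mk (lamC ∘ e.symm) fun h => hC _ _ h⟩, fun α => ?_⟩
  obtain ⟨Ψ, -, hΨ⟩ := hram fun f => α (Finset.univ.image (e ∘ f))
  have hinj : Injective (e ∘ Ψ) := e.injective.comp Ψ.injective
  have hadj : ∀ u v, (C.comap e.symm).Adj (e (Ψ u)) (e (Ψ v)) ↔ B.Adj u v := by
    intro u v
    simp only [SimpleGraph.comap_adj, Equiv.symm_apply_apply]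
    exact Ψ.map_adj_iff
  let val : MonotoneExtension n X → Fin k := fun p =>
    if h : ∃ f : Fin a → Fin b, StrictMono f ∧ B.comap f = p.1.1 ∧ (col ∘ ρ) ∘ f = p.1.2 then
      α (Finset.univ.image (e ∘ Ψ ∘ h.choose)) else Classical.arbitrary _
  have := Fintype.ofFinite (MonotoneExtension n X)
  refine ⟨Finset.univ.image (e ∘ Ψ), ⟨e ∘ Ψ ∘ ρ.symm, hinj.comp ρ.symm.injective, ?_, ?_⟩,
    Finset.univ.image val, ?_, ?_⟩
  · intro i j
    refine (hadj _ _).trans ?_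
    simp [B]
  · ext x
    simp only [Finset.mem_image, Finset.mem_univ, true_and, comp_apply]
    exact (ρ.symm.surjective.exists (p := fun u => e (Ψ u) = x)).symm
  · refine Finset.card_image_le.trans ?_
    rw [TauNum, Finset.card_univ, Nat.card_eq_fintype_card]
  · rintro S hST ⟨g₀, hg₀, hg₀adj, hS⟩
    let S' : Finset (Fin b) := Finset.univ.filter fun u => e (Ψ u) ∈ S
    have himg : S'.image (e ∘ Ψ) = S := by
      ext x
      simp only [S', Finset.mem_image, Finset.mem_filter, Finset.mem_univ, true_and, comp_apply]
      constructor
      · rintro ⟨u, hu, rfl⟩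
        exact hu
      · intro hx
        obtain ⟨u, -, rfl⟩ := Finset.mem_image.1 (hST hx)
        exact ⟨u, hx, rfl⟩
    have hcard : S'.card = a := by
      rw [← Finset.card_image_of_injective S' hinj, himg, ← hS,
        Finset.card_image_of_injective _ hg₀, Finset.card_univ, Fintype.card_fin]
    let f : Fin a → Fin b := S'.orderEmbOfFin hcard
    have hf : StrictMono f := (S'.orderEmbOfFin hcard).strictMono
    have hfS : Finset.univ.image (e ∘ Ψ ∘ f) = S := by
      rw [← himg, ← comp_assoc, ← Finset.image_image]
      congr 1
      exact Finset.coe_injective (by simp [f])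
    have hrange : Set.range (e ∘ Ψ ∘ f) = Set.range g₀ := by
      have := congrArg (fun s : Finset _ => (s : Set (Fin (Fintype.card W)))) (hfS.trans hS.symm)
      simpa only [Finset.coe_image, Finset.coe_univ, Set.image_univ] using this
    have hX : (C.comap e.symm).comap g₀ = X := by
      ext i j; exact hg₀adj i j
    have hBf : (C.comap e.symm).comap (e ∘ Ψ ∘ f) = B.comap f := by
      ext i j; exact hadj _ _
    have hiso : Nonempty (B.comap f ≃g X) := by
      rw [← hX, ← hBf]
      exact SimpleGraph.nonempty_comap_iso_of_range_eq _ (hinj.comp hf.injective) hg₀ hrange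
    let p : MonotoneExtension n X :=
      ⟨(B.comap f, (col ∘ ρ) ∘ f), hiso, fun i j h => hB _ _ h, hρ.comp hf.monotone⟩
    refine Finset.mem_image.2 ⟨p, Finset.mem_univ _, ?_⟩
    have h : ∃ f : Fin a → Fin b, StrictMono f ∧ B.comap f = p.1.1 ∧ (col ∘ ρ) ∘ f = p.1.2 :=
      ⟨f, hf, rfl, rfl⟩
    simp only [val, dif_pos h]
    rw [← hfS]
    obtain ⟨h1, h2, h3⟩ := h.choose_spec
    exact hΨ _ _ h1 hf h2 h3

open Function in
/-- Ordering property: there is an `n`-colorable graph all of whose monotone orderings contain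
every ordered monotonically colored graph on `a` vertices. -/
theorem exists_graph_ordering_property (n a : ℕ) :
    ∃ (b : ℕ) (Y : SimpleGraph (Fin b)), Y.Colorable n ∧
      ∀ (c : ℕ) (Z : SimpleGraph (Fin c)) (lamZ : Fin c → Fin n), ProperCol Z lamZ →
        Monotone lamZ → ∀ g : Y ↪g Z, ∀ (A : SimpleGraph (Fin a)) (mu : Fin a → Fin n),
          ProperCol A mu → Monotone mu →
          ∃ h : Fin a → Fin b, StrictMono (g ∘ h) ∧ Z.comap (g ∘ h) = A ∧ lamZ ∘ g ∘ h = mu := by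
  classical
  let P := {q : SimpleGraph (Fin a) × (Fin a → Fin n) × Equiv.Perm (Fin a) // ProperCol q.1 q.2.1}
  have := Fintype.ofFinite P
  let eP : P ≃ Fin (Fintype.card P) := Fintype.equivFin P
  let W := Fin (Fintype.card P) ×ₗ Fin a
  have : Fintype W := Fintype.ofEquiv _ toLex
  let q : W → P := fun w => eP.symm (ofLex w).1
  let pos : W → Fin a := fun w => (q w).1.2.2 (ofLex w).2
  let B : SimpleGraph W :=
    { Adj := fun x y => (ofLex x).1 = (ofLex y).1 ∧ (q x).1.1.Adj (pos x) (pos y)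
      symm := ⟨fun x y h => ⟨h.1.symm, by
        have hq : q x = q y := congrArg eP.symm h.1
        rw [← hq]; exact h.2.symm⟩⟩
      loopless := ⟨fun x h => (q x).1.1.loopless.irrefl _ h.2⟩ }
  let lam : W → Fin n := fun w => (q w).1.2.1 (pos w)
  have hlam : ∀ u v, B.Adj u v → lam u ≠ lam v := by
    intro u v h
    have hq : q u = q v := congrArg eP.symm h.1
    have := (q u).2 _ _ h.2
    simpa only [lam, ← hq] using this
  obtain ⟨V, _, C, lamC, hC, hram⟩ := exists_colored_ramsey (a := 2) (κ := Prop) B lam hlam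
  have := Fintype.ofFinite V
  let D : SimpleGraph (V ⊕ Fin n) :=
    { Adj := fun x y => match x, y with
        | .inl u, .inl v => C.Adj u v
        | .inl u, .inr i => lamC u ≠ i
        | .inr i, .inl u => lamC u ≠ i
        | .inr i, .inr j => i ≠ j
      symm := ⟨by
        rintro (u | i) (v | j) h
        exacts [SimpleGraph.Adj.symm (G := C) h, h, h, Ne.symm h]⟩
      loopless := ⟨by
        rintro (u | i) h
        exacts [C.loopless.irrefl _ h, h rfl]⟩ }
  let e : V ⊕ Fin n ≃ Fin (Fintype.card (V ⊕ Fin n)) := Fintype.equivFin _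
  refine ⟨_, D.comap e.symm, ⟨SimpleGraph.Coloring.mk (Sum.elim lamC id ∘ e.symm) ?_⟩, ?_⟩
  · intro x y h
    change D.Adj (e.symm x) (e.symm y) at h
    simp only [comp_apply]
    revert h
    rcases e.symm x with u | i <;> rcases e.symm y with v | j <;> intro h
    exacts [hC _ _ h, h, Ne.symm h, h]
  intro c Z lamZ hZ hmono g A mu hA hmu
  let g' : D ↪g Z := g.comp ⟨e.toEmbedding, by intro x y; simp⟩
  let σ : Fin n → Fin n := fun i => lamZ (g' (.inr i))
  have hσ : Injective σ := by
    intro i j hij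
    by_contra hne
    exact hZ _ _ (g'.map_adj_iff.2 (show D.Adj (.inr i) (.inr j) from hne)) hij
  have hσC : ∀ u, lamZ (g' (.inl u)) = σ (lamC u) := by
    intro u
    obtain ⟨i, hi⟩ := (Finite.surjective_of_injective hσ) (lamZ (g' (.inl u)))
    rw [← hi]
    by_contra hne
    exact hZ _ _ (g'.map_adj_iff.2 (show D.Adj (.inl u) (.inr i) from
      fun h => hne (by rw [h]))) hi.symm
  obtain ⟨Ψ, hΨlam, hΨ⟩ := hram fun f => g' (.inl (f 0)) < g' (.inl (f 1))
  let σ' := Equiv.ofBijective σ (Finite.injective_iff_bijective.1 hσ)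
  let keeps : Fin n → Prop := fun i => ∃ x y : W, x < y ∧ lam x = i ∧ lam y = i ∧
    g' (.inl (Ψ x)) < g' (.inl (Ψ y))
  have nadj : ∀ x y, lam x = lam y → ¬ B.Adj x y := fun x y h h' => hlam _ _ h' h
  have hkeeps : ∀ x y : W, x < y → lam x = lam y →
      (g' (.inl (Ψ x)) < g' (.inl (Ψ y)) ↔ keeps (lam x)) := by
    intro x y hxy hl
    refine ⟨fun h => ⟨x, y, hxy, rfl, hl.symm, h⟩, ?_⟩
    rintro ⟨x', y', hxy', hx', hy', h⟩
    have mono2 : ∀ u v : W, u < v → StrictMono ![u, v] := by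
      intro u v huv i j hij
      fin_cases i <;> fin_cases j <;> simp_all
    have := hΨ ![x', y'] ![x, y] (mono2 _ _ hxy') (mono2 _ _ hxy) ?_ ?_
    · exact this.mp h
    · ext i j
      fin_cases i <;> fin_cases j <;>
        simp [nadj, hx', hy', hl]
    · funext i
      fin_cases i <;> simp [hx', hy', hl]
  let nu : Fin a → Fin n := fun s => σ'.symm (mu s)
  let key : Fin a → ℤ := fun s => if keeps (nu s) then (s : ℤ) else -(s : ℤ)
  let ρ : Equiv.Perm (Fin a) := Tuple.sort key
  have hρ : Monotone (key ∘ ρ) := Tuple.monotone_sort key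
  have hlt : ∀ s t, key s < key t → ρ.symm s < ρ.symm t := by
    intro s t h
    by_contra hle
    have := hρ (not_lt.1 hle)
    simp only [comp_apply, Equiv.apply_symm_apply] at this
    exact absurd h (not_lt.2 this)
  let idx : P := ⟨(A, nu, ρ), fun i j h h' => hA i j h (σ'.symm.injective h')⟩
  let h : Fin a → W := fun s => toLex (eP idx, ρ.symm s)
  have hq : ∀ s, q (h s) = idx := fun s => eP.symm_apply_apply idx
  have hpos : ∀ s, pos (h s) = s := by
    intro s
    simp only [pos, hq]
    exact ρ.apply_symm_apply s
  have hlamh : ∀ s, lam (h s) = nu s := by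
    intro s
    simp only [lam, hq, hpos, idx]
  have hBh : ∀ s t, B.Adj (h s) (h t) ↔ A.Adj s t := by
    intro s t
    simp only [B, hq, hpos, idx]
    exact and_iff_right rfl
  have hcol : ∀ s, lamZ (g' (.inl (Ψ (h s)))) = mu s := by
    intro s
    rw [hσC, hΨlam, hlamh]
    exact σ'.apply_symm_apply (mu s)
  have hstrict : ∀ s t, s < t → g' (.inl (Ψ (h s))) < g' (.inl (Ψ (h t))) := by
    intro s t hst
    rcases (hmu hst.le).lt_or_eq with hlt' | heq
    · by_contra hle
      have := hmono (not_lt.1 hle)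
      rw [hcol, hcol] at this
      exact absurd hlt' (not_lt.2 this)
    · have hnu : nu s = nu t := congrArg σ'.symm heq
      have hll : lam (h s) = lam (h t) := by rw [hlamh, hlamh, hnu]
      have hst' : (s : ℤ) < (t : ℤ) := by exact_mod_cast hst
      by_cases hk : keeps (nu s)
      · have hk' : keeps (nu t) := hnu ▸ hk
        have h1 : ρ.symm s < ρ.symm t := hlt s t (by simpa only [key, hk, hk', if_true] using hst')
        have h2 : h s < h t := Prod.Lex.toLex_lt_toLex.2 (Or.inr ⟨rfl, h1⟩)
        exact (hkeeps _ _ h2 hll).2 (by rwa [hlamh])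
      · have hk' : ¬ keeps (nu t) := hnu ▸ hk
        have h1 : ρ.symm t < ρ.symm s := hlt t s (by
          simp only [key, hk, hk', if_false]; omega)
        have h2 : h t < h s := Prod.Lex.toLex_lt_toLex.2 (Or.inr ⟨rfl, h1⟩)
        have h3 : ¬ g' (.inl (Ψ (h t))) < g' (.inl (Ψ (h s))) := by
          rw [hkeeps _ _ h2 hll.symm, hlamh]
          exact hk'
        refine lt_of_le_of_ne (not_lt.1 h3) fun h4 => ?_
        exact h2.ne' (Ψ.injective (Sum.inl_injective (g'.injective h4)))
  refine ⟨fun s => e (.inl (Ψ (h s))), fun s t hst => hstrict s t hst, ?_, funext hcol⟩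
  ext s t
  refine Iff.trans ?_ (hBh s t)
  have : Z.Adj (g' (.inl (Ψ (h s)))) (g' (.inl (Ψ (h t)))) ↔ B.Adj (h s) (h t) := by
    rw [g'.map_adj_iff]
    exact Ψ.map_adj_iff
  exact this

open Function in
theorem tauNum_le_of_ramsey {n a t : ℕ} (X : SimpleGraph (Fin a))
    (ht : ∀ (b : ℕ) (Y : SimpleGraph (Fin b)), Y.Colorable n →
      ∀ k : ℕ, ∃ (c : ℕ) (Z : SimpleGraph (Fin c)), Z.Colorable n ∧
        ∀ α : Finset (Fin c) → Fin k, ∃ T : Finset (Fin c), IsCopy Y Z T ∧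
          ∃ V : Finset (Fin k), V.card ≤ t ∧
            ∀ S : Finset (Fin c), S ⊆ T → IsCopy X Z S → α S ∈ V) :
    TauNum n X ≤ t := by
  classical
  rcases isEmpty_or_nonempty (MonotoneExtension n X) with hempty | hne
  · rw [TauNum, Nat.card_of_isEmpty]
    exact Nat.zero_le t
  have := Fintype.ofFinite (MonotoneExtension n X)
  obtain ⟨b, Y, hY, hord⟩ := exists_graph_ordering_property n a
  obtain ⟨c, Z, ⟨col⟩, hZ⟩ := ht b Y hY (Fintype.card (MonotoneExtension n X))
  let en := Fintype.equivFin (MonotoneExtension n X)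
  let ρ : Equiv.Perm (Fin c) := Tuple.sort col
  let Z' := Z.comap ρ
  let Q : Finset (Fin c) → MonotoneExtension n X → Prop := fun S p =>
    ∃ f : Fin a → Fin c, StrictMono f ∧ Finset.univ.image (ρ ∘ f) = S ∧
      Z'.comap f = p.1.1 ∧ (col ∘ ρ) ∘ f = p.1.2
  let α : Finset (Fin c) → Fin (Fintype.card (MonotoneExtension n X)) := fun S =>
    en (if h : ∃ p, Q S p then h.choose else Classical.arbitrary _)
  have hα : ∀ S p, Q S p → α S = en p := by
    intro S p hp
    have h : ∃ p, Q S p := ⟨p, hp⟩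
    simp only [α, dif_pos h]
    congr 1
    obtain ⟨f, hf, hfS, hf1, hf2⟩ := h.choose_spec
    obtain ⟨f', hf', hfS', hf1', hf2'⟩ := hp
    have hff : f = f' := by
      refine (hf.range_inj hf').1 (Set.image_injective.2 ρ.injective ?_)
      have := congrArg (fun s : Finset (Fin c) => (s : Set (Fin c))) (hfS.trans hfS'.symm)
      rw [← Set.range_comp, ← Set.range_comp]
      simpa only [Finset.coe_image, Finset.coe_univ, Set.image_univ] using this
    subst hff
    exact Subtype.ext (Prod.ext (hf1.symm.trans hf1') (hf2.symm.trans hf2'))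
  obtain ⟨T, ⟨g₀, hg₀, hg₀adj, hT⟩, V, hVt, hV⟩ := hZ α
  let g : Y ↪g Z' := ⟨⟨ρ.symm ∘ g₀, ρ.symm.injective.comp hg₀⟩, by
    intro i j
    simpa [Z'] using hg₀adj i j⟩
  have hVuniv : V = Finset.univ := by
    refine Finset.eq_univ_of_forall fun v => ?_
    obtain ⟨p, rfl⟩ := en.surjective v
    obtain ⟨⟨iso⟩, hp1, hp2⟩ := p.2
    obtain ⟨h, hh, hh1, hh2⟩ := hord c Z' (col ∘ ρ) (fun i j hij => col.valid hij)
      (Tuple.monotone_sort col) g p.1.1 p.1.2 hp1 hp2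
    rw [← hα (Finset.univ.image (ρ ∘ g ∘ h)) p ⟨g ∘ h, hh, rfl, hh1, hh2⟩]
    refine hV _ ?_ ⟨ρ ∘ g ∘ h ∘ iso.symm, ?_, ?_, ?_⟩
    · intro x hx
      obtain ⟨s, -, rfl⟩ := Finset.mem_image.1 hx
      rw [← hT]
      exact Finset.mem_image.2 ⟨h s, Finset.mem_univ _, (ρ.apply_symm_apply _).symm⟩
    · exact ρ.injective.comp (hh.injective.comp iso.symm.injective)
    · intro i j
      rw [← iso.symm.map_adj_iff]
      exact iff_of_eq (congrArg (fun H : SimpleGraph (Fin a) => H.Adj (iso.symm i) (iso.symm j)) hh1)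
    · ext x
      simp only [Finset.mem_image, Finset.mem_univ, true_and, comp_apply]
      exact (iso.symm.surjective.exists (p := fun s => ρ (g (h s)) = x)).symm
  rw [hVuniv, Finset.card_univ, Fintype.card_fin] at hVt
  rwa [TauNum, Nat.card_eq_fintype_card]

/-- every finite `n`-colorable graph `X` has Ramsey degree in `C_n`
equal to `τ(X)`. -/
theorem stmt_11 (n : ℕ) (hn : 1 ≤ n) (a : ℕ)
    (X : SimpleGraph (Fin a)) (hX : X.Colorable n) :
    IsLeast {t : ℕ |
      ∀ (b : ℕ) (Y : SimpleGraph (Fin b)), Y.Colorable n →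
        ∀ k : ℕ, ∃ (c : ℕ) (Z : SimpleGraph (Fin c)), Z.Colorable n ∧
          ∀ α : Finset (Fin c) → Fin k,
            ∃ T : Finset (Fin c), IsCopy Y Z T ∧
              ∃ V : Finset (Fin k), V.card ≤ t ∧
                ∀ S : Finset (Fin c), S ⊆ T → IsCopy X Z S → α S ∈ V}
      (TauNum n X) := by
  exact ⟨fun b Y hY k => exists_graph_few_values X Y hY, fun t ht => tauNum_le_of_ramsey X ht⟩
end

section
/- Fix an integer n ≥ 1 and let X be an element of the class C_n of all finite n-colorable graphs. Then there exists T ∈ C_n such that for every U ∈ C_n there is a map α from the copies of X in U to {1,…,τ(X)} with the property that for every copy T̃ of T in U, the map α attains all τ(X) values on the copies of X in T̃. Consequently the Ramsey degree of X in C_n is at least τ(X). -/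
/-- The set of valid Ramsey degrees of an unordered graph `X` in `C_n`. -/
def UnordDegSet (n : ℕ) {a : ℕ} (X : SimpleGraph (Fin a)) : Set ℕ :=
  {t | ∀ (b : ℕ) (Y : SimpleGraph (Fin b)), Y.Colorable n →
    ∀ k : ℕ, ∃ (c : ℕ) (Z : SimpleGraph (Fin c)), Z.Colorable n ∧
      ∀ α : Finset (Fin c) → Fin k,
        ∃ T : Finset (Fin c), IsCopy Y Z T ∧
          ∃ V : Finset (Fin k), V.card ≤ t ∧
            ∀ S : Finset (Fin c), S ⊆ T → IsCopy X Z S → α S ∈ V}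

/-- Any function to `ℕ` can be realigned, by a permutation, with a given injective one. -/
lemma exists_perm_lt_of_lt {V : Type} [Fintype V] (r s : V → ℕ) (hs : Function.Injective s) :
    ∃ τ : Equiv.Perm V, ∀ u v, r u < r v → s (τ u) < s (τ v) := by
  let e := (Fintype.equivFin V).symm
  let ρ := Tuple.sort (r ∘ e)
  let θ := Tuple.sort (s ∘ e)
  have hρ : Monotone ((r ∘ e) ∘ ρ) := Tuple.monotone_sort _
  have hθ : StrictMono ((s ∘ e) ∘ θ) := (Tuple.monotone_sort _).strictMono_of_injective
    ((hs.comp e.injective).comp θ.injective)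
  refine ⟨e.symm.trans (ρ.symm.trans (θ.trans e)), fun u v huv => ?_⟩
  have hlt : ρ.symm (e.symm u) < ρ.symm (e.symm v) := by
    by_contra hle
    have h := hρ (not_lt.1 hle)
    simp only [Function.comp_apply, Equiv.apply_symm_apply] at h
    omega
  simpa using hθ hlt

/-- The graph keeping the color class `i` of `G` and taking one copy of the rest of `G` for every
permutation of that class, attached to the class through the permutation. -/
def permExpansion {n : ℕ} {V : Type} (G : SimpleGraph V) (c : G.Coloring (Fin n)) (i : Fin n) :
    SimpleGraph ({v // c v = i} ⊕ ({v // c v ≠ i} × Equiv.Perm {v // c v = i})) where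
  Adj
    | .inl _, .inl _ => False
    | .inl u, .inr v => G.Adj (v.2 u) v.1
    | .inr u, .inl v => G.Adj u.1 (u.2 v)
    | .inr u, .inr v => u.2 = v.2 ∧ G.Adj u.1 v.1
  symm := ⟨by
    rintro (u | u) (v | v) h
    · exact h
    · exact SimpleGraph.Adj.symm h
    · exact SimpleGraph.Adj.symm h
    · exact ⟨h.1.symm, SimpleGraph.Adj.symm h.2⟩⟩
  loopless := ⟨by
    rintro (u | u) h
    · exact h
    · exact G.loopless.irrefl _ h.2⟩

/-- The coloring of `permExpansion G c i` induced by `c`. -/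
def permExpansionColoring {n : ℕ} {V : Type} (G : SimpleGraph V) (c : G.Coloring (Fin n))
    (i : Fin n) : (permExpansion G c i).Coloring (Fin n) :=
  SimpleGraph.Coloring.mk (Sum.elim (fun u => c u) (fun u => c u.1)) (by
    rintro (u | u) (v | v) h
    · exact h.elim
    · simpa [u.2] using v.1.2.symm
    · simpa [v.2] using u.1.2
    · exact c.valid h.2)

/-- Whatever the order on the color class `i` of the expansion, some copy of `G` in it
has its color class `i` ordered as prescribed. -/
lemma exists_embedding_permExpansion {n : ℕ} {V : Type} [Fintype V] (G : SimpleGraph V)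
    (c : G.Coloring (Fin n)) (i : Fin n) (r : V → ℕ)
    (s : {v // c v = i} ⊕ ({v // c v ≠ i} × Equiv.Perm {v // c v = i}) → ℕ)
    (hs : Function.Injective s) :
    ∃ e : G ↪g permExpansion G c i,
      (∀ v, permExpansionColoring G c i (e v) = c v) ∧
      (∀ u v, c u = i → c v = i → r u < r v → s (e u) < s (e v)) ∧
      ∀ v, c v ≠ i → Sum.elim (fun _ => 0) (fun u => r u.1) (e v) = r v := by
  classical
  obtain ⟨τ, hτ⟩ := exists_perm_lt_of_lt (fun u : {v // c v = i} => r u) (fun u => s (.inl u))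
    (hs.comp Sum.inl_injective)
  let f : V → {v // c v = i} ⊕ ({v // c v ≠ i} × Equiv.Perm {v // c v = i}) :=
    fun v => if h : c v = i then .inl (τ ⟨v, h⟩) else .inr (⟨v, h⟩, τ⁻¹)
  have hf₁ (v : V) (h : c v = i) : f v = .inl (τ ⟨v, h⟩) := dif_pos h
  have hf₂ (v : V) (h : c v ≠ i) : f v = .inr (⟨v, h⟩, τ⁻¹) := dif_neg h
  have hinj : Function.Injective f := by
    intro u v huv
    by_cases hu : c u = i <;> by_cases hv : c v = i
    · simpa [hf₁ u hu, hf₁ v hv] using huv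
    · simp [hf₁ u hu, hf₂ v hv] at huv
    · simp [hf₂ u hu, hf₁ v hv] at huv
    · simpa [hf₂ u hu, hf₂ v hv] using huv
  have hadj (u v : V) : (permExpansion G c i).Adj (f u) (f v) ↔ G.Adj u v := by
    by_cases hu : c u = i <;> by_cases hv : c v = i
    · rw [hf₁ u hu, hf₁ v hv]
      exact ⟨False.elim, fun h => c.valid h (hu.trans hv.symm)⟩
    · simp [hf₁ u hu, hf₂ v hv, permExpansion]
    · simp [hf₂ u hu, hf₁ v hv, permExpansion]
    · simp [hf₂ u hu, hf₂ v hv, permExpansion]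
  refine ⟨⟨⟨f, hinj⟩, hadj _ _⟩, fun v => ?_, fun u v hu hv huv => ?_, fun v hv => ?_⟩
  · change permExpansionColoring G c i (f v) = c v
    by_cases hv : c v = i
    · rw [hf₁ v hv]
      exact (τ ⟨v, hv⟩).2.trans hv.symm
    · rw [hf₂ v hv]
      rfl
  · change s (f u) < s (f v)
    rw [hf₁ u hu, hf₁ v hv]
    exact hτ ⟨u, hu⟩ ⟨v, hv⟩ huv
  · change Sum.elim _ _ (f v) = r v
    rw [hf₂ v hv]
    rfl

/-- Ordering property for colored graphs, relative to a set `C` of colors: there is a colored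
graph such that every order on it, extending a fixed preorder in the color classes outside `C`,
admits a copy of `G` ordered as prescribed in each color class. -/
lemma exists_ordering_graph {n : ℕ} (C : Finset (Fin n)) {V : Type} [Fintype V]
    (G : SimpleGraph V) (c : G.Coloring (Fin n)) (r : V → ℕ) :
    ∃ (V' : Type) (_ : Fintype V') (G' : SimpleGraph V') (c' : G'.Coloring (Fin n))
      (r' : V' → ℕ), ∀ s : V' → ℕ, Function.Injective s →
        (∀ u v, c' u = c' v → c' u ∉ C → r' u < r' v → s u < s v) →
        ∃ e : G ↪g G', (∀ v, c' (e v) = c v) ∧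
          ∀ u v, c u = c v → r u < r v → s (e u) < s (e v) := by
  classical
  induction C using Finset.induction_on with
  | empty =>
    exact ⟨V, ‹_›, G, c, r, fun s _ h =>
      ⟨SimpleGraph.Embedding.refl, fun _ => rfl, fun u v huv => h u v huv (by simp)⟩⟩
  | insert i C _ ih =>
    obtain ⟨V₁, _, G₁, c₁, r₁, h₁⟩ := ih
    refine ⟨_, inferInstance, permExpansion G₁ c₁ i, permExpansionColoring G₁ c₁ i,
      Sum.elim (fun _ => 0) (fun u => r₁ u.1), fun s hs hsr => ?_⟩
    obtain ⟨e, hec, hei, her⟩ := exists_embedding_permExpansion G₁ c₁ i r₁ s hs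
    obtain ⟨e', hec', hes'⟩ := h₁ (s ∘ e) (hs.comp e.injective) (fun u v huv hu hr => by
      by_cases hi : c₁ u = i
      · exact hei u v hi (huv ▸ hi) hr
      · refine hsr _ _ (by rw [hec, hec, huv]) (by rw [hec]; simp [hi, hu]) ?_
        rwa [her u hi, her v (huv ▸ hi)])
    exact ⟨e'.trans e, fun v => (hec _).trans (hec' v), hes'⟩

/-- The graph `G` together with a clique on the set of colors, a color being joined to the
vertices not having this color. -/
def addColorClique {n : ℕ} {V : Type} (G : SimpleGraph V) (c : G.Coloring (Fin n)) :
    SimpleGraph (V ⊕ Fin n) where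
  Adj
    | .inl u, .inl v => G.Adj u v
    | .inl u, .inr j => c u ≠ j
    | .inr j, .inl u => c u ≠ j
    | .inr i, .inr j => i ≠ j
  symm := ⟨by
    rintro (u | u) (v | v) h
    · exact SimpleGraph.Adj.symm h
    · exact h
    · exact h
    · exact Ne.symm h⟩
  loopless := ⟨by
    rintro (u | u) h
    · exact G.loopless.irrefl _ h
    · exact h rfl⟩

lemma addColorClique_colorable {n : ℕ} {V : Type} (G : SimpleGraph V) (c : G.Coloring (Fin n)) :
    (addColorClique G c).Colorable n :=
  ⟨SimpleGraph.Coloring.mk (Sum.elim c id) (by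
    rintro (u | u) (v | v) h
    · exact c.valid h
    · exact h
    · exact Ne.symm h
    · exact h)⟩

/-- `G` has only one `n`-coloring extending to `addColorClique G c`, up to a permutation. -/
lemma exists_perm_coloring_eq {n : ℕ} {V : Type} (G : SimpleGraph V) (c : G.Coloring (Fin n))
    (κ : (addColorClique G c).Coloring (Fin n)) :
    ∃ π : Equiv.Perm (Fin n), ∀ v, κ (.inl v) = π (c v) := by
  have hinj : Function.Injective fun j => κ (.inr j) := by
    intro i j hij
    by_contra hne
    exact κ.valid (v := .inr i) (w := .inr j) hne hij
  refine ⟨Equiv.ofBijective _ (Finite.injective_iff_bijective.1 hinj), fun v => ?_⟩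
  obtain ⟨j, hj⟩ := (Finite.injective_iff_bijective.1 hinj).2 (κ (.inl v))
  by_cases hv : c v = j
  · subst hv
    exact hj.symm
  · exact (κ.valid (v := .inl v) (w := .inr j) hv hj.symm).elim

/-- The extensions of `X` in the class of monotone ordered `[n]`-colored graphs. -/
abbrev MonoExt (n : ℕ) {a : ℕ} (X : SimpleGraph (Fin a)) : Type :=
  {p : SimpleGraph (Fin a) × (Fin a → Fin n) //
    Nonempty (p.1 ≃g X) ∧ ProperCol p.1 p.2 ∧ Monotone p.2}

lemma nonempty_monoExt {n a : ℕ} {X : SimpleGraph (Fin a)} (hX : X.Colorable n) :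
    Nonempty (MonoExt n X) := by
  obtain ⟨c⟩ := hX
  let σ := Tuple.sort c
  exact ⟨(X.comap σ, c ∘ σ), ⟨SimpleGraph.Iso.comap σ X⟩, fun i j h => c.valid h,
    Tuple.monotone_sort _⟩

/-- With `U` colored by `κ` and its vertices ordered lexicographically by color and index, `S` is
the vertex set of a copy of the ordered colored graph `p` in `U`. -/
def IsMonoCopy {n a d : ℕ} (p : SimpleGraph (Fin a) × (Fin a → Fin n))
    (U : SimpleGraph (Fin d)) (κ : Fin d → Fin n) (S : Finset (Fin d)) : Prop :=
  ∃ g : Fin a → Fin d, StrictMono (fun x => toLex (κ (g x), g x)) ∧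
    (∀ x y, U.Adj (g x) (g y) ↔ p.1.Adj x y) ∧ (∀ x, κ (g x) = p.2 x) ∧
    Finset.image g Finset.univ = S

lemma IsMonoCopy.eq {n a d : ℕ} {p q : SimpleGraph (Fin a) × (Fin a → Fin n)}
    {U : SimpleGraph (Fin d)} {κ : Fin d → Fin n} {S : Finset (Fin d)}
    (hp : IsMonoCopy p U κ S) (hq : IsMonoCopy q U κ S) : p = q := by
  obtain ⟨g, hg, hga, hgc, hgS⟩ := hp
  obtain ⟨f, hf, hfa, hfc, hfS⟩ := hq
  have hrange : Set.range g = Set.range f := by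
    have h := congrArg (fun A : Finset (Fin d) => (A : Set (Fin d))) (hgS.trans hfS.symm)
    simpa using h
  have hlex : Set.range (fun x => toLex (κ (g x), g x)) =
      Set.range (fun x => toLex (κ (f x), f x)) := by
    have h := congrArg (Set.image fun y => toLex (κ y, y)) hrange
    rwa [← Set.range_comp, ← Set.range_comp] at h
  have hgf : g = f := by
    funext x
    have h := congrFun ((hg.range_inj hf).1 hlex) x
    exact congrArg (fun y => (ofLex y).2) h
  subst hgf
  refine Prod.ext ?_ ?_
  · ext x y
    rw [← hga, ← hfa]
  · funext x
    rw [← hgc, ← hfc]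

lemma IsMonoCopy.isCopy {n a d : ℕ} {X : SimpleGraph (Fin a)} (p : MonoExt n X)
    {U : SimpleGraph (Fin d)} {κ : Fin d → Fin n} {S : Finset (Fin d)}
    (hp : IsMonoCopy p.1 U κ S) : IsCopy X U S := by
  obtain ⟨g, hg, hga, -, rfl⟩ := hp
  obtain ⟨φ⟩ := p.2.1
  have hinj : Function.Injective g := fun x y h => hg.injective (by simp [h])
  refine ⟨g ∘ φ.symm, hinj.comp φ.symm.injective, fun i j => ?_, ?_⟩
  · rw [Function.comp_apply, Function.comp_apply, hga, φ.symm.map_adj_iff]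
  · rw [← Finset.image_image, Finset.image_univ_of_surjective φ.symm.surjective]

/-- The disjoint union of all extensions of `X`, with all permutations of their colorings. -/
def sumMonoExt (n : ℕ) {a : ℕ} (X : SimpleGraph (Fin a)) :
    SimpleGraph (MonoExt n X × Equiv.Perm (Fin n) × Fin a) where
  Adj u v := u.1 = v.1 ∧ u.2.1 = v.2.1 ∧ u.1.1.1.Adj u.2.2 v.2.2
  symm := ⟨fun _ _ h => ⟨h.1.symm, h.2.1.symm, h.1 ▸ h.2.2.symm⟩⟩
  loopless := ⟨fun u h => u.1.1.1.loopless.irrefl _ h.2.2⟩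

/-- The coloring of `sumMonoExt n X` by the permuted colorings of the extensions. -/
def sumMonoExtColoring (n : ℕ) {a : ℕ} (X : SimpleGraph (Fin a)) :
    (sumMonoExt n X).Coloring (Fin n) :=
  SimpleGraph.Coloring.mk (fun u => u.2.1 (u.1.1.2 u.2.2)) (by
    rintro ⟨p, π, x⟩ ⟨q, ρ, y⟩ ⟨h₁, h₂, h⟩
    dsimp only at h₁ h₂ h
    subst h₁ h₂
    exact fun heq => p.2.2.1 x y h (π.injective heq))

/-- Expansion property: some `n`-colorable graph contains all extensions of `X`, whatever
monotone `n`-coloring and order it is given. -/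
lemma exists_graph_forall_isMonoCopy (n : ℕ) {a : ℕ} (X : SimpleGraph (Fin a)) :
    ∃ (c : ℕ) (T : SimpleGraph (Fin c)), T.Colorable n ∧
      ∀ (d : ℕ) (U : SimpleGraph (Fin d)) (κ : U.Coloring (Fin n)) (W : Finset (Fin d)),
        IsCopy T U W → ∀ p : MonoExt n X, ∃ S ⊆ W, IsMonoCopy p.1 U κ S := by
  classical
  have := Fintype.ofFinite (MonoExt n X)
  obtain ⟨V, _, G, c, r, h⟩ := exists_ordering_graph Finset.univ (sumMonoExt n X)
    (sumMonoExtColoring n X) (fun u => u.2.2)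
  let φ := (addColorClique G c).overFinIso rfl
  refine ⟨_, (addColorClique G c).overFin rfl,
    (addColorClique_colorable G c).of_hom φ.symm.toHom, ?_⟩
  rintro d U κ W ⟨f, hf, hfa, rfl⟩ p
  let ψ : addColorClique G c ↪g U := φ.toEmbedding.trans ⟨⟨f, hf⟩, hfa _ _⟩
  obtain ⟨π, hπ⟩ := exists_perm_coloring_eq G c (κ.comp ψ.toHom)
  obtain ⟨e, hec, her⟩ := h (fun v => (ψ (.inl v)).val)
    (Fin.val_injective.comp (ψ.injective.comp Sum.inl_injective)) (by simp)
  let g : Fin a → Fin d := fun x => ψ (.inl (e (p, π⁻¹, x)))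
  have hgc (x : Fin a) : κ (g x) = p.1.2 x := by
    refine (hπ _).trans ?_
    rw [hec]
    exact π.apply_symm_apply _
  refine ⟨Finset.image g Finset.univ, ?_, g, fun x y hxy => ?_, fun x y => ?_, hgc, rfl⟩
  · intro y hy
    obtain ⟨x, -, rfl⟩ := Finset.mem_image.1 hy
    exact Finset.mem_image_of_mem f (Finset.mem_univ _)
  · rw [Prod.Lex.toLex_lt_toLex, hgc, hgc]
    refine (p.2.2.2 hxy.le).lt_or_eq.imp_right fun heq => ⟨heq, ?_⟩
    exact her (p, π⁻¹, x) (p, π⁻¹, y) (congrArg (π⁻¹ : Equiv.Perm (Fin n)) heq) hxy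
  · refine ψ.map_adj_iff.trans (e.map_adj_iff.trans ?_)
    simp [sumMonoExt]

/-- lower bound: there is `T ∈ C_n` such that every `U ∈ C_n` admits
a `τ(X)`-coloring of the copies of `X` attaining all `τ(X)` values on the copies of
`X` inside each copy of `T`; hence the Ramsey degree of `X` in `C_n` is ≥ `τ(X)`. -/
theorem stmt_13 (n : ℕ) (hn : 1 ≤ n) (a : ℕ)
    (X : SimpleGraph (Fin a)) (hX : X.Colorable n) :
    (∃ (c : ℕ) (T : SimpleGraph (Fin c)), T.Colorable n ∧
      ∀ (d : ℕ) (U : SimpleGraph (Fin d)), U.Colorable n →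
        ∃ α : Finset (Fin d) → Fin (TauNum n X),
          ∀ W : Finset (Fin d), IsCopy T U W →
            ∀ v, ∃ S : Finset (Fin d), S ⊆ W ∧ IsCopy X U S ∧ α S = v) ∧
    ∀ t ∈ UnordDegSet n X, TauNum n X ≤ t := by
  classical
  have hne := nonempty_monoExt hX
  let ε : MonoExt n X ≃ Fin (TauNum n X) := Finite.equivFin _
  have hT : ∃ (c : ℕ) (T : SimpleGraph (Fin c)), T.Colorable n ∧
      ∀ (d : ℕ) (U : SimpleGraph (Fin d)), U.Colorable n →
        ∃ α : Finset (Fin d) → Fin (TauNum n X),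
          ∀ W : Finset (Fin d), IsCopy T U W →
            ∀ v, ∃ S : Finset (Fin d), S ⊆ W ∧ IsCopy X U S ∧ α S = v := by
    obtain ⟨c, T, hTn, h⟩ := exists_graph_forall_isMonoCopy n X
    refine ⟨c, T, hTn, fun d U ⟨κ⟩ => ?_⟩
    refine ⟨fun S => ε (Classical.epsilon fun p : MonoExt n X => IsMonoCopy p.1 U κ S),
      fun W hW v => ?_⟩
    obtain ⟨S, hSW, hS⟩ := h d U κ W hW (ε.symm v)
    refine ⟨S, hSW, hS.isCopy, ?_⟩
    have hS' := Classical.epsilon_spec (p := fun p : MonoExt n X => IsMonoCopy p.1 U κ S) ⟨_, hS⟩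
    change ε (Classical.epsilon _) = v
    rw [Subtype.ext (hS'.eq hS), ε.apply_symm_apply]
  refine ⟨hT, fun t ht => ?_⟩
  obtain ⟨c, T, hTn, h⟩ := hT
  obtain ⟨d, Z, hZ, hα⟩ := ht c T hTn (TauNum n X)
  obtain ⟨α, hα'⟩ := h d Z hZ
  obtain ⟨W, hW, V, hV, hVα⟩ := hα α
  have huniv : V = Finset.univ := by
    refine Finset.eq_univ_of_forall fun v => ?_
    obtain ⟨S, hSW, hS, rfl⟩ := hα' W hW v
    exact hVα S hSW hS
  simpa [huniv] using hV
end

section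
/- Fix an integer n ≥ 1. Every element X of the class χ_n of all finite n-chromatic graphs has a finite Ramsey degree in χ_n equal to τ(X), the number of non-isomorphic extensions of X in M^<_n. That is: τ(X) is the least natural number t such that for every Y ∈ χ_n and every k ∈ ℕ there exists Z ∈ χ_n such that for every map α from the copies of X in Z to {1,…,k} there is a copy Ỹ of Y in Z such that α takes at most t values on the copies of X in Ỹ. -/
/-- Prehomogeneous sets: if every sufficiently large finite set of naturals contains a set of size
`m` homogeneous for a given coloring of its `a`-subsets, then every sufficiently large finite set
contains a set of size `m` on which the color of an `(a + 1)`-subset depends only on its least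
element. -/
theorem exists_prehomogeneous {κ : Type} [Nonempty κ] (a : ℕ)
    (ih : ∀ m : ℕ, ∃ N : ℕ, ∀ (U : Finset ℕ) (χ : Finset ℕ → κ), N ≤ U.card →
      ∃ H ⊆ U, H.card = m ∧ ∃ c, ∀ s ⊆ H, s.card = a → χ s = c) (m : ℕ) :
    ∃ N : ℕ, ∀ (U : Finset ℕ) (χ : Finset ℕ → κ), N ≤ U.card →
      ∃ H ⊆ U, H.card = m ∧ ∃ φ : ℕ → κ, ∀ x ∈ H, ∀ s ⊆ H, s.card = a →
        (∀ y ∈ s, x < y) → χ (insert x s) = φ x := by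
  induction m with
  | zero =>
    refine ⟨0, fun U χ _ => ⟨∅, by simp, rfl, fun _ => Classical.arbitrary κ, by simp⟩⟩
  | succ m ihm =>
    obtain ⟨M, hM⟩ := ihm
    obtain ⟨N, hN⟩ := ih M
    refine ⟨N + 1, fun U χ hU => ?_⟩
    have hne : U.Nonempty := Finset.card_pos.mp (by omega)
    set x := U.min' hne with hx
    have hxU : x ∈ U := U.min'_mem hne
    obtain ⟨H₁, hH₁, hc₁, c, hc⟩ := hN (U.erase x) (fun s => χ (insert x s))
      (by rw [Finset.card_erase_of_mem hxU]; omega)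
    obtain ⟨H₂, hH₂, hc₂, φ, hφ⟩ := hM H₁ χ hc₁.ge
    have hlt : ∀ y ∈ H₂, x < y := fun y hy => by
      have := Finset.mem_erase.mp (hH₁ (hH₂ hy))
      exact lt_of_le_of_ne (U.min'_le y this.2) this.1.symm
    have hxH : x ∉ H₂ := fun h => lt_irrefl _ (hlt x h)
    refine ⟨insert x H₂, ?_, by rw [Finset.card_insert_of_notMem hxH, hc₂],
      Function.update φ x c, ?_⟩
    · intro y hy
      rcases Finset.mem_insert.mp hy with rfl | hy
      · exact hxU
      · exact Finset.mem_of_mem_erase (hH₁ (hH₂ hy))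
    · intro y hy s hs hsa hys
      have hxs : x ∉ s := fun h => by
        have h1 := hys x h
        rcases Finset.mem_insert.mp hy with rfl | hy
        · exact lt_irrefl _ h1
        · exact lt_asymm h1 (hlt y hy)
      have hsH : s ⊆ H₂ := fun z hz => (Finset.mem_insert.mp (hs hz)).resolve_left
        (fun h => hxs (h ▸ hz))
      rcases Finset.mem_insert.mp hy with rfl | hy
      · rw [Function.update_self]
        exact hc s (hsH.trans hH₂) hsa
      · rw [Function.update_of_ne (hlt y hy).ne']
        exact hφ y hy s hsH hsa hys

/-- The finite Ramsey theorem for colorings of the `a`-subsets of finite sets of naturals. -/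
theorem exists_homogeneous {κ : Type} [Finite κ] [Nonempty κ] (a : ℕ) :
    ∀ m : ℕ, ∃ N : ℕ, ∀ (U : Finset ℕ) (χ : Finset ℕ → κ), N ≤ U.card →
      ∃ H ⊆ U, H.card = m ∧ ∃ c, ∀ s ⊆ H, s.card = a → χ s = c := by
  classical
  cases nonempty_fintype κ
  induction a with
  | zero =>
    refine fun m => ⟨m, fun U χ hU => ?_⟩
    obtain ⟨H, hH, hc⟩ := Finset.exists_subset_card_eq hU
    refine ⟨H, hH, hc, χ ∅, fun s _ hs => ?_⟩
    rw [Finset.card_eq_zero.mp hs]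
  | succ a ih =>
    intro m
    obtain ⟨N, hN⟩ := exists_prehomogeneous a ih (Fintype.card κ * m)
    refine ⟨N, fun U χ hU => ?_⟩
    obtain ⟨H, hHU, hcard, φ, hφ⟩ := hN U χ hU
    obtain ⟨c, -, hc⟩ := Finset.exists_le_card_fiber_of_mul_le_card_of_maps_to
      (s := H) (t := Finset.univ) (f := φ) (n := m) (by simp) Finset.univ_nonempty
      (by rw [Finset.card_univ, hcard])
    obtain ⟨H', hH', hc'⟩ := Finset.exists_subset_card_eq hc
    refine ⟨H', fun x hx => hHU (Finset.mem_filter.mp (hH' hx)).1, hc', c, fun s hs hsa => ?_⟩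
    have hne : s.Nonempty := Finset.card_pos.mp (by omega)
    have hmem := s.min'_mem hne
    have hsub : s ⊆ H := fun x hx => (Finset.mem_filter.mp (hH' (hs hx))).1
    have key := hφ (s.min' hne) (hsub hmem) (s.erase (s.min' hne))
      ((Finset.erase_subset _ _).trans hsub) (by rw [Finset.card_erase_of_mem hmem]; omega)
      (fun y hy => Finset.min'_lt_of_mem_erase_min' s hne hy)
    rw [Finset.insert_erase hmem] at key
    rw [key]
    exact (Finset.mem_filter.mp (hH' (hs hmem))).2

/-- The finite Ramsey theorem for colorings of increasing maps. -/
theorem exists_strictMono_homogeneous (κ : Type) [Finite κ] [Nonempty κ] (a b : ℕ) :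
    ∃ N : ℕ, ∀ χ : (Fin a → Fin N) → κ, ∃ h : Fin b → Fin N, StrictMono h ∧
      ∃ c, ∀ e : Fin a → Fin b, StrictMono e → χ (h ∘ e) = c := by
  classical
  obtain ⟨N, hN⟩ := exists_homogeneous (κ := κ) a b
  refine ⟨N, fun χ => ?_⟩
  obtain ⟨H, hHU, hcard, c, hc⟩ := hN (Finset.range N)
    (fun s => if h : ∃ e : Fin a → Fin N, StrictMono e ∧
      Finset.univ.image (fun i => (e i : ℕ)) = s then χ h.choose else Classical.arbitrary κ)
    (by simp)
  have hlt : ∀ i, H.orderEmbOfFin hcard i < N := fun i =>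
    Finset.mem_range.mp (hHU (H.orderEmbOfFin_mem hcard i))
  have hmono : StrictMono fun i => (⟨H.orderEmbOfFin hcard i, hlt i⟩ : Fin N) := fun i j hij =>
    Fin.mk_lt_mk.mpr ((H.orderEmbOfFin hcard).strictMono hij)
  refine ⟨_, hmono, c, fun e he => ?_⟩
  set h : Fin b → Fin N := fun i => ⟨H.orderEmbOfFin hcard i, hlt i⟩ with hh
  have hhe : StrictMono (h ∘ e) := hmono.comp he
  have hex : ∃ e' : Fin a → Fin N, StrictMono e' ∧ Finset.univ.image (fun i => (e' i : ℕ)) =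
      Finset.univ.image (fun i => ((h ∘ e) i : ℕ)) := ⟨h ∘ e, hhe, rfl⟩
  have key := hc (Finset.univ.image (fun i => ((h ∘ e) i : ℕ)))
    (by
      intro y hy
      obtain ⟨i, -, rfl⟩ := Finset.mem_image.mp hy
      exact H.orderEmbOfFin_mem hcard _)
    (by
      exact (Finset.card_image_of_injective _ (Fin.val_injective.comp hhe.injective)).trans
        (by simp))
  rw [dif_pos hex] at key
  have heq : hex.choose = h ∘ e := by
    refine (StrictMono.range_inj hex.choose_spec.1 hhe).mp ?_
    have h2 := congrArg (fun s : Finset ℕ => (s : Set ℕ)) hex.choose_spec.2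
    simp only [Finset.coe_image, Finset.coe_univ, Set.image_univ] at h2
    have h3 : ∀ f : Fin a → Fin N,
        Set.range (fun i => (f i : ℕ)) = (Fin.val : Fin N → ℕ) '' Set.range f := fun f => by
      rw [← Set.range_comp]; rfl
    rw [h3, h3] at h2
    exact Fin.val_injective.image_injective h2
  rw [← heq, key]

/-- Partite lemma: for finite labelled structures `A` on `I` and `R` on `V`, where `V` is
partitioned by `π`, and for parts `e`, some finite `W` partitioned by `ρ` has the property that
whenever the maps `I → W` are colored, there is an embedding `V → W` respecting the parts
for which all transversal copies of `A` over the parts `e` get the same color. -/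
theorem exists_partite_ramsey_s14 {L κ I Q V : Type} [Nonempty L] [Finite κ] [Finite I] [Finite Q]
    [Finite V] (A : I → I → L) (e : I → Q) (he : Function.Injective e)
    (R : V → V → L) (π : V → Q) :
    ∃ (W : Type) (_ : Finite W) (S : W → W → L) (ρ : W → Q), ∀ χ : (I → W) → κ,
      ∃ g : V → W, (∀ u v, S (g u) (g v) = R u v) ∧ (∀ v, ρ (g v) = π v) ∧
        ∃ c, ∀ f : I → V, (∀ i, π (f i) = e i) → (∀ i j, R (f i) (f j) = A i j) →
          χ (g ∘ f) = c := by
  classical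
  let C := {f : I → V // (∀ i, π (f i) = e i) ∧ ∀ i j, R (f i) (f j) = A i j}
  obtain ⟨ι, _, hι⟩ := Combinatorics.Line.exists_mono_in_high_dimension C κ
  -- `P x y ℓ`: some coordinate of the pair `x, y` carries the label `ℓ`
  let P : Q × (ι → Option V) → Q × (ι → Option V) → L → Prop := fun x y ℓ =>
    ∃ t u v, x.2 t = some u ∧ y.2 t = some v ∧ R u v = ℓ
  let E : Q → Q → L → Prop := fun p q ℓ => ∃ i j, p = e i ∧ q = e j ∧ ℓ = A i j
  let S : Q × (ι → Option V) → Q × (ι → Option V) → L := fun x y =>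
    if h : ∃ ℓ, P x y ℓ ∧ ¬ E x.1 y.1 ℓ then h.choose
    else if h : ∃ ℓ, P x y ℓ then h.choose else Classical.arbitrary L
  refine ⟨Q × (ι → Option V), inferInstance, S, Prod.fst, fun χ => ?_⟩
  obtain ⟨l, c, hl⟩ := hι fun w => χ fun i => (e i, fun t => some ((w t).1 i))
  let g : V → Q × (ι → Option V) := fun b => (π b, fun t =>
    match l.idxFun t with
    | none => some b
    | some f => if h : ∃ i, π b = e i then some (f.1 h.choose) else none)
  have hg_none : ∀ b t, l.idxFun t = none → (g b).2 t = some b := fun b t ht => by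
    simp only [g, ht]
  have hg_some : ∀ b t f u, l.idxFun t = some f → (g b).2 t = some u →
      ∃ i, π b = e i ∧ u = f.1 i := fun b t f u ht hu => by
    simp only [g, ht] at hu
    split_ifs at hu with h
    exact ⟨_, h.choose_spec, (Option.some.inj hu).symm⟩
  have hP : ∀ b b' ℓ, P (g b) (g b') ℓ → ℓ = R b b' ∨ E (π b) (π b') ℓ := by
    rintro b b' ℓ ⟨t, u, v, hu, hv, rfl⟩
    cases ht : l.idxFun t with
    | none =>
      rw [hg_none _ _ ht] at hu hv
      left; rw [Option.some.inj hu, Option.some.inj hv]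
    | some f =>
      obtain ⟨i, hi, rfl⟩ := hg_some _ _ _ _ ht hu
      obtain ⟨j, hj, rfl⟩ := hg_some _ _ _ _ ht hv
      exact Or.inr ⟨i, j, hi, hj, f.2.2 i j⟩
  have hP' : ∀ b b', P (g b) (g b') (R b b') := fun b b' => by
    obtain ⟨t, ht⟩ := l.proper
    exact ⟨t, b, b', hg_none _ _ ht, hg_none _ _ ht, rfl⟩
  refine ⟨g, fun b b' => ?_, fun _ => rfl, c, fun f hf hR => ?_⟩
  · by_cases h : ∃ ℓ, P (g b) (g b') ℓ ∧ ¬ E (g b).1 (g b').1 ℓ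
    · have : S (g b) (g b') = h.choose := dif_pos h
      rw [this]
      exact (hP _ _ _ h.choose_spec.1).resolve_right h.choose_spec.2
    · have h' : ∃ ℓ, P (g b) (g b') ℓ := ⟨_, hP' b b'⟩
      have : S (g b) (g b') = h'.choose := (dif_neg h).trans (dif_pos h')
      rw [this]
      push Not at h
      rcases hP _ _ _ h'.choose_spec with h1 | ⟨i, j, hi, hj, h1⟩
      · exact h1
      · obtain ⟨i', j', hi', hj', h2⟩ := h _ (hP' b b')
        rw [h1, h2, he (hi.symm.trans hi'), he (hj.symm.trans hj')]
  · rw [← hl ⟨f, hf, hR⟩]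
    congr 1
    funext i
    refine Prod.ext (hf i) (funext fun t => ?_)
    change (g (f i)).2 t = some ((l ⟨f, hf, hR⟩ t).1 i)
    cases ht : l.idxFun t with
    | none =>
      rw [Combinatorics.Line.apply_none l _ t ht]
      exact hg_none _ _ ht
    | some w =>
      rw [Combinatorics.Line.apply_some ht]
      have h : ∃ j, π (f i) = e j := ⟨i, hf i⟩
      have h2 : h.choose = i := he (h.choose_spec.symm.trans (hf i))
      simp only [g, ht, dif_pos h, h2]

/-- Iterated partite lemma. -/
theorem exists_partite_ramsey_list {L κ I Q T : Type} [Nonempty L] [Finite κ] [Finite I]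
    [Finite Q] (A : T → I → I → L) (l : List (T × {e : I → Q // Function.Injective e})) :
    ∀ (V : Type) [Finite V] (R : V → V → L) (π : V → Q),
    ∃ (W : Type) (_ : Finite W) (S : W → W → L) (ρ : W → Q), ∀ χ : (I → W) → κ,
      ∃ g : V → W, (∀ u v, S (g u) (g v) = R u v) ∧ (∀ v, ρ (g v) = π v) ∧
        ∀ p ∈ l, ∃ c, ∀ f : I → V, (∀ i, π (f i) = p.2.1 i) →
          (∀ i j, R (f i) (f j) = A p.1 i j) → χ (g ∘ f) = c := by
  induction l with
  | nil => exact fun V _ R π => ⟨V, inferInstance, R, π, fun χ => ⟨id, by simp⟩⟩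
  | cons p l ih =>
    intro V _ R π
    obtain ⟨W₁, _, S₁, ρ₁, h₁⟩ := exists_partite_ramsey_s14 (κ := κ) (A p.1) p.2.1 p.2.2 R π
    obtain ⟨W₂, hW₂, S₂, ρ₂, h₂⟩ := ih W₁ S₁ ρ₁
    refine ⟨W₂, hW₂, S₂, ρ₂, fun χ => ?_⟩
    obtain ⟨g₂, hS₂, hρ₂, hc₂⟩ := h₂ χ
    obtain ⟨g₁, hS₁, hρ₁, hc₁⟩ := h₁ fun f => χ (g₂ ∘ f)
    refine ⟨g₂ ∘ g₁, fun u v => (hS₂ _ _).trans (hS₁ _ _),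
      fun v => (hρ₂ _).trans (hρ₁ _), fun q hq => ?_⟩
    rcases List.mem_cons.mp hq with rfl | hq
    · exact hc₁
    · obtain ⟨c, hc⟩ := hc₂ q hq
      exact ⟨c, fun f hf hR => hc (g₁ ∘ f) (fun i => (hρ₁ _).trans (hf i))
        fun i j => (hS₁ _ _).trans (hR i j)⟩

/-- The Ramsey theorem for ordered finite structures with a labelling of all pairs: a finite
structure `B` is contained in some finite structure `W`, partitioned by `ρ` into linearly ordered
parts, such that whenever maps to `W` are colored there is a transversal copy of `B` for which the
color of the copies of any member of the family `A` only depends on the member. -/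
theorem exists_ordered_ramsey_s14 {L κ T : Type} [Nonempty L] [Finite κ] [Nonempty κ] [Finite T]
    {a b : ℕ} (A : T → Fin a → Fin a → L) (B : Fin b → Fin b → L) :
    ∃ (W : Type) (_ : Finite W) (S : W → W → L), ∀ χ : (Fin a → W) → κ,
      ∃ g : Fin b → W, Function.Injective g ∧ (∀ u v, S (g u) (g v) = B u v) ∧
        ∃ c : T → κ, ∀ (p : T) (f : Fin a → Fin b), StrictMono f →
          (∀ i j, B (f i) (f j) = A p i j) → χ (g ∘ f) = c p := by
  classical
  obtain ⟨N, hN⟩ := exists_strictMono_homogeneous (T → κ) a b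
  cases nonempty_fintype T
  obtain ⟨W, hW, S, ρ, h⟩ := exists_partite_ramsey_list (κ := κ) (Q := Fin N) A
    Finset.univ.toList ((Fin b → Fin N) × Fin b) (fun u v => B u.2 v.2) (fun u => u.1 u.2)
  refine ⟨W, hW, S, fun χ => ?_⟩
  obtain ⟨g, hS, hρ, hc⟩ := h χ
  have hc' : ∀ (p : T) (e : Fin a → Fin N), ∃ c, Function.Injective e →
      ∀ f : Fin a → (Fin b → Fin N) × Fin b, (∀ i, (f i).1 (f i).2 = e i) →
        (∀ i j, B (f i).2 (f j).2 = A p i j) → χ (g ∘ f) = c := by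
    intro p e
    by_cases he : Function.Injective e
    · obtain ⟨c, hc⟩ := hc (p, ⟨e, he⟩) (by simp)
      exact ⟨c, fun _ => hc⟩
    · exact ⟨Classical.arbitrary κ, fun h => absurd h he⟩
  choose c hc' using hc'
  obtain ⟨h, hmono, d, hd⟩ := hN fun e p => c p e
  refine ⟨fun x => g (h, x), fun x y hxy => ?_, fun u v => hS _ _, d, fun p f hf hB => ?_⟩
  · have := congrArg ρ hxy
    rw [hρ, hρ] at this
    exact hmono.injective this
  · rw [← hd f hf]
    exact hc' p (h ∘ f) (hmono.comp hf).injective (fun i => (h, f i)) (fun _ => rfl) hB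

/-- Any weak order on a finite type can be carried into any linear order by a permutation. -/
theorem exists_perm_lt_of_lt_s14 {W : Type} [Finite W] {α β : Type} [LinearOrder α] [LinearOrder β]
    (rank : W → α) (r : W → β) (hr : Function.Injective r) :
    ∃ f : Equiv.Perm W, ∀ x y, rank x < rank y → r (f x) < r (f y) := by
  obtain ⟨m, ⟨E⟩⟩ := Finite.exists_equiv_fin W
  let s₁ : Fin m ≃ W := (Tuple.sort (rank ∘ E.symm)).trans E.symm
  let s₂ : Fin m ≃ W := (Tuple.sort (r ∘ E.symm)).trans E.symm
  have h₁ : Monotone (rank ∘ s₁) := Tuple.monotone_sort (rank ∘ E.symm)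
  have h₂ : StrictMono (r ∘ s₂) :=
    (Tuple.monotone_sort (r ∘ E.symm)).strictMono_of_injective (hr.comp s₂.injective)
  refine ⟨s₁.symm.trans s₂, fun x y hxy => h₂ ?_⟩
  by_contra! hle
  have := h₁ hle
  simp only [Function.comp, Equiv.apply_symm_apply] at this
  exact absurd hxy this.not_gt

/-- The ordering property for a single part `j` of a finite relational structure, whose
parts are weakly ordered by `rank`. -/
theorem exists_ordering_part {Q V : Type} [Finite V] (j : Q) (q : V → Q) (R : V → V → Prop)
    (rank : V → ℕ) :
    ∃ (W : Type) (_ : Finite W) (q' : W → Q) (R' : W → W → Prop) (rank' : W → ℕ),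
      ∀ r : W → ℕ, Function.Injective r → ∃ g : V → W, Function.Injective g ∧
        (∀ u, q' (g u) = q u) ∧ (∀ u v, q u ≠ q v → (R' (g u) (g v) ↔ R u v)) ∧
        (∀ u v, q u = j → q v = j → rank u < rank v → r (g u) < r (g v)) ∧
        ∀ u v, q u ≠ j → q v ≠ j → rank u < rank v → rank' (g u) < rank' (g v) := by
  classical
  let decode : V × Option (Equiv.Perm V) → Equiv.Perm V → V :=
    fun x f => if x.2 = none then f.symm x.1 else x.1
  refine ⟨V × Option (Equiv.Perm V), inferInstance, fun x => if x.2 = none then j else q x.1,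
    fun x y => ∃ f, x.2.or y.2 = some f ∧ R (decode x f) (decode y f), fun x => rank x.1,
    fun r hr => ?_⟩
  obtain ⟨f, hf⟩ := exists_perm_lt_of_lt_s14 rank (fun u => r (u, none))
    (fun u v h => (Prod.ext_iff.mp (hr h)).1)
  refine ⟨fun u => if q u = j then (f u, none) else (u, some f), ?_, ?_, ?_, ?_, ?_⟩
  · intro u v huv
    by_cases hu : q u = j <;> by_cases hv : q v = j <;> simp_all
  · intro u
    by_cases hu : q u = j <;> simp [hu]
  · intro u v huv
    by_cases hu : q u = j <;> by_cases hv : q v = j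
    · exact absurd (hu.trans hv.symm) huv
    all_goals simp [hu, hv, decode]
  · intro u v hu hv huv
    simpa [hu, hv] using hf u v huv
  · intro u v hu hv huv
    simpa [hu, hv] using huv

/-- The ordering property for a list of parts of a finite relational structure. -/
theorem exists_ordering_list {Q : Type} (l : List Q) :
    ∀ (V : Type) [Finite V] (q : V → Q) (R : V → V → Prop) (rank : V → ℕ),
    ∃ (W : Type) (_ : Finite W) (q' : W → Q) (R' : W → W → Prop),
      ∀ r : W → ℕ, Function.Injective r → ∃ g : V → W, Function.Injective g ∧
        (∀ u, q' (g u) = q u) ∧ (∀ u v, q u ≠ q v → (R' (g u) (g v) ↔ R u v)) ∧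
        ∀ u v, q u = q v → q u ∈ l → rank u < rank v → r (g u) < r (g v) := by
  induction l with
  | nil =>
    exact fun V _ q R rank => ⟨V, inferInstance, q, R, fun r _ => ⟨id, Function.injective_id,
      by simp⟩⟩
  | cons j l ih =>
    intro V _ q R rank
    obtain ⟨W₁, _, q₁, R₁, rank₁, h₁⟩ := exists_ordering_part j q R rank
    obtain ⟨W₂, hW₂, q₂, R₂, h₂⟩ := ih W₁ q₁ R₁ rank₁
    refine ⟨W₂, hW₂, q₂, R₂, fun r hr => ?_⟩
    obtain ⟨g₂, hi₂, hq₂, hR₂, hr₂⟩ := h₂ r hr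
    obtain ⟨g₁, hi₁, hq₁, hR₁, hj₁, hr₁⟩ := h₁ (r ∘ g₂) (hr.comp hi₂)
    refine ⟨g₂ ∘ g₁, hi₂.comp hi₁, fun u => (hq₂ _).trans (hq₁ u), fun u v huv => ?_,
      fun u v huv hl hlt => ?_⟩
    · exact (hR₂ _ _ (by rwa [hq₁, hq₁])).trans (hR₁ u v huv)
    · by_cases hj : q u = j
      · exact hj₁ u v hj (huv ▸ hj) hlt
      · refine hr₂ _ _ (by rw [hq₁, hq₁, huv]) ?_ (hr₁ u v hj (huv ▸ hj) hlt)
        rw [hq₁]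
        exact (List.mem_cons.mp hl).resolve_left hj

/-- A graph with `n` forced color classes: for any proper `n`-coloring and any compatible order it
contains every monotone ordered `n`-colored graph on `a` vertices. -/
theorem exists_ordering_graph_s14 (n : ℕ) (hn : 1 ≤ n) (a : ℕ) :
    ∃ (b : ℕ) (Y : SimpleGraph (Fin b)), (Y.Colorable n ∧ ¬ Y.Colorable (n - 1)) ∧
      ∀ (r : Fin b → ℕ) (μ : Fin b → Fin n), Function.Injective r → ProperCol Y μ →
        (∀ u v, r u ≤ r v → μ u ≤ μ v) → ∀ (H : SimpleGraph (Fin a)) (lam : Fin a → Fin n),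
          ProperCol H lam → Monotone lam → ∃ e : Fin a → Fin b,
            (∀ i j, Y.Adj (e i) (e j) ↔ H.Adj i j) ∧ (∀ i, μ (e i) = lam i) ∧
              StrictMono (r ∘ e) := by
  classical
  obtain ⟨W, _, q, R, hW⟩ := exists_ordering_list (List.finRange n)
    ((SimpleGraph (Fin a) × (Fin a → Fin n)) × Fin a) (fun u => u.1.2 u.2)
    (fun u v => u.1.1.Adj u.2 v.2) (fun u => u.2)
  let col : W ⊕ Fin n → Fin n := Sum.elim q id
  let G : SimpleGraph (W ⊕ Fin n) :=
    { Adj := fun x y => col x ≠ col y ∧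
        ∀ u v, x = Sum.inl u → y = Sum.inl v → R u v ∧ R v u
      symm := ⟨fun x y h => ⟨h.1.symm, fun u v hu hv => (h.2 v u hv hu).symm⟩⟩
      loopless := ⟨fun x h => h.1 rfl⟩ }
  have hinr : ∀ (x : W ⊕ Fin n) (j : Fin n), col x ≠ j → G.Adj x (Sum.inr j) :=
    fun x j h => ⟨h, fun _ _ _ h => by cases h⟩
  obtain ⟨b, ⟨E⟩⟩ := Finite.exists_equiv_fin (W ⊕ Fin n)
  refine ⟨b, G.comap E.symm, ⟨⟨SimpleGraph.Coloring.mk (fun x => col (E.symm x))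
    fun h => h.1⟩, ?_⟩, ?_⟩
  · rintro ⟨c⟩
    have hinj : Function.Injective fun i : Fin n => c (E (Sum.inr i)) := by
      intro i j hij
      by_contra hne
      refine c.valid (v := E (Sum.inr i)) (w := E (Sum.inr j)) ?_ hij
      simpa using hinr (Sum.inr i) j hne
    have := Fintype.card_le_of_injective _ hinj
    simp only [Fintype.card_fin] at this
    omega
  · intro r μ hr hμ hmono H lam hlam hlmono
    have hval : ∀ x j, col x ≠ j → μ (E x) ≠ μ (E (Sum.inr j)) := fun x j h =>
      hμ _ _ (by simpa using hinr x j h)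
    have hinj : Function.Injective fun i : Fin n => μ (E (Sum.inr i)) := fun i j hij => by
      by_contra hne
      exact hval (Sum.inr i) j hne hij
    let σ : Equiv.Perm (Fin n) :=
      Equiv.ofBijective _ (Finite.injective_iff_bijective.mp hinj)
    have hσ : ∀ x, μ (E x) = σ (col x) := fun x => by
      obtain ⟨j, hj⟩ := σ.surjective (μ (E x))
      by_cases h : col x = j
      · rw [h, hj]
      · exact absurd hj.symm (hval x j h)
    obtain ⟨g, -, hq, hR, hlt⟩ := hW (fun u => r (E (Sum.inl u)))
      (hr.comp (E.injective.comp Sum.inl_injective))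
    let e : Fin a → Fin b := fun i => E (Sum.inl (g ((H, σ.symm ∘ lam), i)))
    have hcol : ∀ i, μ (e i) = lam i := fun i => by
      simp only [e, hσ]
      exact (congrArg σ (hq _)).trans (σ.apply_symm_apply _)
    refine ⟨e, fun i j => ?_, hcol, fun i j hij => ?_⟩
    · have hadj : (G.comap E.symm).Adj (e i) (e j) ↔
          q (g ((H, σ.symm ∘ lam), i)) ≠ q (g ((H, σ.symm ∘ lam), j)) ∧
          (R (g ((H, σ.symm ∘ lam), i)) (g ((H, σ.symm ∘ lam), j)) ∧
            R (g ((H, σ.symm ∘ lam), j)) (g ((H, σ.symm ∘ lam), i))) := by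
        simp [G, e, col]
      rw [hadj, hq, hq]
      constructor
      · rintro ⟨h1, h2, -⟩
        exact (hR _ _ h1).mp h2
      · intro h
        have hne : σ.symm (lam i) ≠ σ.symm (lam j) := fun h' =>
          hlam i j h (σ.symm.injective h')
        exact ⟨hne, (hR _ _ hne).mpr h, (hR _ _ hne.symm).mpr h.symm⟩
    · rcases (hlmono hij.le).lt_or_eq with h | h
      · by_contra! hle
        have := hmono _ _ hle
        rw [hcol, hcol] at this
        exact absurd h this.not_gt
      · exact hlt _ _ (congrArg σ.symm h) (List.mem_finRange _) hij

/-- The Ramsey degree of `X` is at least `TauNum n X`. -/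
theorem tauNum_le (n : ℕ) (hn : 1 ≤ n) (a : ℕ) (X : SimpleGraph (Fin a)) (t : ℕ)
    (ht : ∀ (b : ℕ) (Y : SimpleGraph (Fin b)), (Y.Colorable n ∧ ¬ Y.Colorable (n - 1)) →
      ∀ k : ℕ, ∃ (c : ℕ) (Z : SimpleGraph (Fin c)),
        (Z.Colorable n ∧ ¬ Z.Colorable (n - 1)) ∧
        ∀ α : Finset (Fin c) → Fin k,
          ∃ T : Finset (Fin c), IsCopy Y Z T ∧
            ∃ V : Finset (Fin k), V.card ≤ t ∧
              ∀ S : Finset (Fin c), S ⊆ T → IsCopy X Z S → α S ∈ V) :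
    TauNum n X ≤ t := by
  classical
  unfold TauNum
  set P := {p : SimpleGraph (Fin a) × (Fin a → Fin n) //
    Nonempty (p.1 ≃g X) ∧ ProperCol p.1 p.2 ∧ Monotone p.2} with hP
  rcases isEmpty_or_nonempty P with hemp | ⟨⟨p₀⟩⟩
  · simp
  obtain ⟨b, Y, hY, hYW⟩ := exists_ordering_graph_s14 n hn a
  obtain ⟨c, Z, ⟨⟨μ⟩, -⟩, hZ⟩ := ht b Y hY (Nat.card P)
  let code : P ≃ Fin (Nat.card P) := Finite.equivFin P
  let σ := Tuple.sort μ
  have hσ : Monotone (μ ∘ σ) := Tuple.monotone_sort μ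
  have hσ' : ∀ u v, σ.symm u ≤ σ.symm v → μ u ≤ μ v := fun u v h => by
    simpa using hσ h
  let IsType : P → (Fin a → Fin c) → Prop := fun p e =>
    (∀ i j, Z.Adj (e i) (e j) ↔ p.1.1.Adj i j) ∧ (∀ i, μ (e i) = p.1.2 i) ∧
      StrictMono (σ.symm ∘ e)
  have huniq : ∀ p p' e e', IsType p e → IsType p' e' →
      Finset.univ.image e = Finset.univ.image e' → p = p' := by
    intro p p' e e' h h' himg
    have hrange : Set.range e = Set.range e' := by
      simpa using congrArg (fun s : Finset (Fin c) => (s : Set (Fin c))) himg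
    have hee : σ.symm ∘ e = σ.symm ∘ e' :=
      (StrictMono.range_inj h.2.2 h'.2.2).mp (by rw [Set.range_comp, Set.range_comp, hrange])
    have hee' : e = e' := funext fun i => σ.symm.injective (congrFun hee i)
    subst hee'
    refine Subtype.ext (Prod.ext ?_ (funext fun i => (h.2.1 i).symm.trans (h'.2.1 i)))
    ext i j
    exact (h.1 i j).symm.trans (h'.1 i j)
  obtain ⟨T, ⟨f, hfinj, hf, rfl⟩, V, hVt, hV⟩ := hZ fun S =>
    if h : ∃ p e, IsType p e ∧ Finset.univ.image e = S then code h.choose else code p₀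
  have hall : ∀ p, code p ∈ V := by
    intro p
    obtain ⟨e, he, hcol, hmono⟩ := hYW (fun u => σ.symm (f u)) (fun u => μ (f u))
      (Fin.val_injective.comp (σ.symm.injective.comp hfinj))
      (fun i j h => μ.valid ((hf i j).mpr h))
      (fun u v h => hσ' _ _ (Fin.le_def.mpr h)) p.1.1 p.1.2 p.2.2.1 p.2.2.2
    have htype : IsType p (f ∘ e) :=
      ⟨fun i j => (hf _ _).trans (he i j), hcol, fun i j hij => hmono hij⟩
    have hex : ∃ p' e', IsType p' e' ∧ Finset.univ.image e' = Finset.univ.image (f ∘ e) :=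
      ⟨p, _, htype, rfl⟩
    obtain ⟨φ⟩ := p.2.1
    have hmem := hV (Finset.univ.image (f ∘ e))
      (by
        intro x hx
        obtain ⟨i, -, rfl⟩ := Finset.mem_image.mp hx
        exact Finset.mem_image_of_mem f (Finset.mem_univ _))
      ⟨f ∘ e ∘ φ.symm, ?_, fun i j => ?_, ?_⟩
    · rw [dif_pos hex] at hmem
      obtain ⟨e', he', himg⟩ := hex.choose_spec
      rwa [huniq _ _ _ _ he' htype himg] at hmem
    · have : Function.Injective (f ∘ e) := hmono.injective.of_comp (f := fun x => (σ.symm x : ℕ))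
      exact this.comp φ.symm.injective
    · exact (htype.1 _ _).trans (φ.symm.map_adj_iff)
    · rw [← Function.comp_assoc, ← Finset.image_image,
        Finset.image_univ_of_surjective φ.symm.surjective]
  have hVuniv : V = Finset.univ := Finset.eq_univ_of_forall fun x => by
    simpa using hall (code.symm x)
  rw [hVuniv] at hVt
  simpa using hVt

/-- The Ramsey degree of `X` is at most `TauNum n X`. -/
theorem ramsey_tauNum (n : ℕ) (hn : 1 ≤ n) (a : ℕ) (X : SimpleGraph (Fin a)) (b : ℕ)
    (Y : SimpleGraph (Fin b)) (hY : Y.Colorable n ∧ ¬ Y.Colorable (n - 1)) (k : ℕ) :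
    ∃ (c : ℕ) (Z : SimpleGraph (Fin c)), (Z.Colorable n ∧ ¬ Z.Colorable (n - 1)) ∧
      ∀ α : Finset (Fin c) → Fin k, ∃ T : Finset (Fin c), IsCopy Y Z T ∧
        ∃ V : Finset (Fin k), V.card ≤ TauNum n X ∧
          ∀ S : Finset (Fin c), S ⊆ T → IsCopy X Z S → α S ∈ V := by
  classical
  rcases Nat.eq_zero_or_pos k with rfl | hk
  · exact ⟨b, Y, hY, fun α => (α ∅).elim0⟩
  have : Nonempty (Fin k) := ⟨⟨0, hk⟩⟩
  have : Nonempty (Fin n) := ⟨⟨0, hn⟩⟩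
  obtain ⟨⟨lam⟩, hYn⟩ := hY
  let P := {p : SimpleGraph (Fin a) × (Fin a → Fin n) //
    Nonempty (p.1 ≃g X) ∧ ProperCol p.1 p.2 ∧ Monotone p.2}
  have hPcard : Nat.card P = TauNum n X := rfl
  let σ := Tuple.sort lam
  have hσ : Monotone (lam ∘ σ) := Tuple.monotone_sort lam
  obtain ⟨W, _, S, hW⟩ := exists_ordered_ramsey_s14 (κ := Fin k)
    (fun (p : P) i j => ((p.1.1.Adj i j, p.1.2 i) : Prop × Fin n))
    (fun u v => (Y.Adj (σ u) (σ v), lam (σ u)))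
  let col : W → Fin n := fun x => (S x x).2
  let G : SimpleGraph W :=
    { Adj := fun x y => col x ≠ col y ∧ (S x y).1 ∧ (S y x).1
      symm := ⟨fun x y h => ⟨h.1.symm, h.2.2, h.2.1⟩⟩
      loopless := ⟨fun x h => h.1 rfl⟩ }
  have hG : ∀ g : Fin b → W, (∀ u v, S (g u) (g v) = (Y.Adj (σ u) (σ v), lam (σ u))) →
      ∀ u v, G.Adj (g u) (g v) ↔ Y.Adj (σ u) (σ v) := by
    intro g hg u v
    simp only [G, col, hg]
    exact ⟨fun h => h.2.1, fun h => ⟨lam.valid h, h, h.symm⟩⟩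
  obtain ⟨c, ⟨E⟩⟩ := Finite.exists_equiv_fin W
  refine ⟨c, G.comap E.symm, ⟨⟨SimpleGraph.Coloring.mk (fun x => col (E.symm x))
    fun h => h.1⟩, fun ⟨d⟩ => hYn ?_⟩, fun α => ?_⟩
  · obtain ⟨g, -, hg, -⟩ := hW fun _ => Classical.arbitrary _
    refine ⟨SimpleGraph.Coloring.mk (fun u => d (E (g (σ.symm u)))) fun {u v} h => d.valid ?_⟩
    simpa [hG g hg] using h
  · obtain ⟨g, hginj, hg, d, hd⟩ := hW fun e => α (Finset.univ.image fun i => E (e i))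
    have hadj : ∀ u v, (G.comap E.symm).Adj (E (g u)) (E (g v)) ↔ Y.Adj (σ u) (σ v) :=
      fun u v => by simpa using hG g hg u v
    refine ⟨Finset.univ.image fun u => E (g u), ⟨fun u => E (g (σ.symm u)), ?_, ?_, ?_⟩,
      Set.Finite.toFinset (Set.finite_range d), ?_, ?_⟩
    · exact E.injective.comp (hginj.comp σ.symm.injective)
    · intro u v
      simpa using hadj (σ.symm u) (σ.symm v)
    · rw [show (fun u => E (g (σ.symm u))) = (fun u => E (g u)) ∘ σ.symm from rfl,
        ← Finset.image_image, Finset.image_univ_of_surjective σ.symm.surjective]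
    · rw [← hPcard, ← Set.ncard_eq_toFinset_card, ← Set.image_univ, ← Set.ncard_univ]
      exact Set.ncard_image_le
    · rintro U hUT ⟨f, hfinj, hf, rfl⟩
      have hfg : ∀ i, ∃ u, E (g u) = f i := fun i => by
        simpa using hUT (Finset.mem_image_of_mem f (Finset.mem_univ i))
      choose h hh using hfg
      have hhinj : Function.Injective h := fun i j hij => hfinj (by rw [← hh, ← hh, hij])
      let s := Tuple.sort h
      have hs : StrictMono (h ∘ s) := (Tuple.monotone_sort h).strictMono_of_injective
        (hhinj.comp s.injective)
      have hX : ∀ i j, X.Adj i j ↔ Y.Adj (σ (h i)) (σ (h j)) := fun i j => by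
        rw [← hf, ← hh, ← hh, hadj]
      let p : P := ⟨(X.comap s, fun i => lam (σ (h (s i)))),
        ⟨⟨s, Iff.rfl⟩⟩, fun i j hij => lam.valid ((hX _ _).mp hij),
        fun i j hij => hσ (hs.monotone hij)⟩
      have hcolor := hd p (h ∘ s) hs fun i j => by
        refine Prod.ext (propext (hX _ _).symm) rfl
      have himg : (Finset.univ.image fun i => E ((g ∘ h ∘ s) i)) = Finset.univ.image f := by
        rw [show (fun i => E ((g ∘ h ∘ s) i)) = f ∘ s from funext fun i => hh (s i),
          ← Finset.image_image, Finset.image_univ_of_surjective s.surjective]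
      rw [himg] at hcolor
      rw [hcolor]
      simp

/-- every finite `n`-chromatic graph `X` has Ramsey degree in `χ_n`
equal to `τ(X)`. -/
theorem stmt_14 (n : ℕ) (hn : 1 ≤ n) (a : ℕ)
    (X : SimpleGraph (Fin a)) (hX : X.Colorable n ∧ ¬ X.Colorable (n - 1)) :
    IsLeast {t : ℕ |
      ∀ (b : ℕ) (Y : SimpleGraph (Fin b)), (Y.Colorable n ∧ ¬ Y.Colorable (n - 1)) →
        ∀ k : ℕ, ∃ (c : ℕ) (Z : SimpleGraph (Fin c)),
          (Z.Colorable n ∧ ¬ Z.Colorable (n - 1)) ∧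
          ∀ α : Finset (Fin c) → Fin k,
            ∃ T : Finset (Fin c), IsCopy Y Z T ∧
              ∃ V : Finset (Fin k), V.card ≤ t ∧
                ∀ S : Finset (Fin c), S ⊆ T → IsCopy X Z S → α S ∈ V}
      (TauNum n X) := by
  exact ⟨ramsey_tauNum n hn a X, fun t ht => tauNum_le n hn a X t ht⟩
end

section
/- Fix an integer n ≥ 1, let X be a finite n-colorable graph, and let Ŷ = (Ŷ, E^Ŷ, <^Ŷ, λ^Ŷ) be an element of M^<_n such that every extension of X in M^<_n embeds into Ŷ. Let < be a linear ordering on the vertex set of Ŷ such that on every λ^Ŷ-color class, < coincides with <^Ŷ or is the reverse of <^Ŷ; let f be a permutation of {1,…,n} and set λ = f ∘ λ^Ŷ. If the structure (Ŷ, E^Ŷ, <, λ) belongs to M^<_n, then every extension of X in M^<_n embeds into (Ŷ, E^Ŷ, <, λ). -/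
/-- The vertices can be relisted so that the colors `mu` increase, keeping the original
order inside the color classes outside `rev` and reversing it inside those in `rev`. -/
theorem exists_perm_monotone_reversing {n a : ℕ} (mu : Fin a → Fin n) (rev : Fin n → Prop) :
    ∃ s : Equiv.Perm (Fin a), Monotone (mu ∘ s) ∧
      (∀ i j, mu i = mu j → ¬ rev (mu i) → i < j → s.symm i < s.symm j) ∧
      (∀ i j, mu i = mu j → rev (mu i) → i < j → s.symm j < s.symm i) := by
  classical
  let key : Fin a → Fin n ×ₗ ℤ := fun i =>
    toLex (mu i, if rev (mu i) then -(i : ℤ) else (i : ℤ))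
  have hs := Tuple.monotone_sort key
  have hlt : ∀ i j, key i < key j → (Tuple.sort key).symm i < (Tuple.sort key).symm j := by
    intro i j h
    refine hs.reflect_lt ?_
    simpa using h
  refine ⟨Tuple.sort key, fun i j h => Prod.Lex.monotone_fst _ _ (hs h), ?_, ?_⟩
  · intro i j he hr hij
    refine hlt i j (Prod.Lex.toLex_lt_toLex.2 (Or.inr ⟨he, ?_⟩))
    have hr' : ¬ rev (mu j) := he ▸ hr
    simpa [hr, hr'] using hij
  · intro i j he hr hij
    refine hlt j i (Prod.Lex.toLex_lt_toLex.2 (Or.inr ⟨he.symm, ?_⟩))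
    have hr' : rev (mu j) := he ▸ hr
    simpa [hr, hr'] using hij

/-- suppose every extension of the `n`-colorable graph `X` in `M^<_n`
embeds into `(Y, <^Y, lamY) ∈ M^<_n`; let `lt` be a linear order on the vertices of
`Y` that coincides with or reverses the natural order on each `lamY`-color class,
and let `f` be a permutation of the colors such that `(Y, lt, f ∘ lamY)` is again
monotone.  Then every extension of `X` in `M^<_n` embeds into `(Y, lt, f ∘ lamY)`. -/
theorem stmt_15 (n : ℕ) (hn : 1 ≤ n) (a b : ℕ)
    (X : SimpleGraph (Fin a)) (hX : X.Colorable n)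
    (Y : SimpleGraph (Fin b)) (lamY : Fin b → Fin n)
    (hY : ProperCol Y lamY) (hYm : Monotone lamY)
    (hext : ∀ (G : SimpleGraph (Fin a)) (lam : Fin a → Fin n),
      Nonempty (G ≃g X) → ProperCol G lam → Monotone lam →
      ∃ e : Fin a → Fin b, ColOrdEmb G lam Y lamY e)
    (lt : Fin b → Fin b → Prop) (hlt : IsStrictTotalOrder (Fin b) lt)
    (hcoin : ∀ col : Fin n,
      (∀ i j, lamY i = col → lamY j = col → (lt i j ↔ i < j)) ∨
      (∀ i j, lamY i = col → lamY j = col → (lt i j ↔ j < i)))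
    (f : Equiv.Perm (Fin n))
    (hmono : ∀ i j, lt i j → f (lamY i) ≤ f (lamY j)) :
    ∀ (G : SimpleGraph (Fin a)) (lam : Fin a → Fin n),
      Nonempty (G ≃g X) → ProperCol G lam → Monotone lam →
      ∃ e : Fin a → Fin b, (∀ i j : Fin a, i < j → lt (e i) (e j)) ∧
        (∀ i j, Y.Adj (e i) (e j) ↔ G.Adj i j) ∧
        (∀ i, f (lamY (e i)) = lam i) := by
  intro G lam hG hprop hlam
  let rev : Fin n → Prop := fun col =>
    ¬ ∀ i j, lamY i = col → lamY j = col → (lt i j ↔ i < j)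
  obtain ⟨s, hs, hkeep, hrev⟩ :=
    exists_perm_monotone_reversing (fun i => f.symm (lam i)) rev
  obtain ⟨e, ⟨he, hadj⟩, hcol⟩ := hext (G.comap s) (fun i => f.symm (lam (s i)))
    ⟨(SimpleGraph.Iso.comap s G).trans hG.some⟩
    (fun i j hij h => hprop _ _ hij (f.symm.injective h)) hs
  have hcol' : ∀ i, lamY (e (s.symm i)) = f.symm (lam i) := by
    intro i
    simpa using hcol (s.symm i)
  refine ⟨fun i => e (s.symm i), ?_, ?_, ?_⟩
  · intro i j hij
    rcases (hlam hij.le).eq_or_lt with heq | hne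
    · have hmu : f.symm (lam i) = f.symm (lam j) := congrArg f.symm heq
      have hj : lamY (e (s.symm j)) = f.symm (lam i) := (hcol' j).trans hmu.symm
      by_cases hr : rev (f.symm (lam i))
      · exact ((hcoin _).resolve_left hr _ _ (hcol' i) hj).2 (he (hrev i j hmu hr hij))
      · exact (not_not.1 hr _ _ (hcol' i) hj).2 (he (hkeep i j hmu hr hij))
    · by_contra hnot
      refine hne.not_ge ?_
      by_cases hji : lt (e (s.symm j)) (e (s.symm i))
      · simpa [hcol'] using hmono _ _ hji
      · have h := congrArg lamY (hlt.trichotomous _ _ hnot hji)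
        rw [hcol', hcol'] at h
        exact (f.symm.injective h).ge
  · intro i j
    simpa using hadj (s.symm i) (s.symm j)
  · intro i
    simp [hcol']
end
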